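/- arXiv:2109.11973 — 3 statements merged into one kernel-verified Lean document; each statement's English description precedes it below -/
import Mathlib

section
/- Let X be a compact Hausdorff space and let μ be a purely atomic Borel probability measure on X, i.e. there are points x_n ∈ X (n ∈ ℕ) and reals r_n ∈ [0,1] with Σ_{n} r_n = 1 such that μ = Σ_{n} r_n · δ_{x_n}, where δ_{x_n} is the Dirac measure at x_n. Then every pointwise bounded family A of continuous real-valued functions on X is μ-stable. -/
open MeasureTheory Filter Topology

/-- The "independence witness" set `D_k` from the definition of `μ`-stability:
tuples `(w_1, …, w_k) ∈ E^k` such that for every `I ⊆ {1,…,k}` there is `f ∈ A`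
with `f(w_i) ≤ s` for `i ∈ I` and `f(w_i) ≥ r` for `i ∉ I`. -/
def stabilityWitness {X : Type*} (A : Set (X → ℝ)) (E : Set X) (s r : ℝ) (k : ℕ) :
    Set (Fin k → X) :=
  {w | (∀ i, w i ∈ E) ∧
    ∀ I : Finset (Fin k), ∃ f ∈ A,
      (∀ i, i ∈ I → f (w i) ≤ s) ∧ (∀ i, i ∉ I → r ≤ f (w i))}

/-- A family `A` of functions is `μ`-stable if there is no `μ`-measurable set `E`
of positive measure and reals `s < r` such that for every `k ≥ 1` the set
`D_k(A, E, s, r)` has full outer `μ^k`-measure `μ(E)^k` in `E^k`.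
(`Measure.pi` applied to an arbitrary set computes the outer measure.) -/
def IsMuStable {X : Type*} [MeasurableSpace X] (μ : Measure X) (A : Set (X → ℝ)) : Prop :=
  ¬ ∃ (E : Set X) (s r : ℝ),
      NullMeasurableSet E μ ∧ 0 < μ E ∧ s < r ∧
      ∀ k : ℕ, 1 ≤ k →
        (Measure.pi fun _ : Fin k => μ) (stabilityWitness A E s r k) = (μ E) ^ k

theorem exists_atom_mem_of_measure_pos {X : Type*} [MeasurableSpace X] [MeasurableSingletonClass X]
    {x : ℕ → X} {r : ℕ → ENNReal} {E : Set X}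
    (hE : 0 < (Measure.sum fun n => r n • Measure.dirac (x n)) E) :
    ∃ n, r n ≠ 0 ∧ x n ∈ E := by
  by_contra! h
  set C : Set X := x '' {n | r n ≠ 0}
  have hCm : MeasurableSet Cᶜ := ((Set.to_countable _).image x).measurableSet.compl
  have hsub : E ⊆ Cᶜ := by
    rintro y hy ⟨n, hn, rfl⟩
    exact h n hn hy
  refine hE.ne' (measure_mono_null hsub ?_)
  rw [Measure.sum_apply _ hCm]
  refine ENNReal.tsum_eq_zero.2 fun n => ?_
  by_cases hn : r n = 0
  · simp [hn]
  · have hx : x n ∉ Cᶜ := fun hx => hx ⟨n, hn, rfl⟩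
    simp [Measure.dirac_apply' _ hCm, hx]

theorem const_notMem_stabilityWitness {X : Type*} (A : Set (X → ℝ)) (E : Set X) {s r : ℝ}
    (hsr : s < r) (p : X) : (fun _ => p) ∉ stabilityWitness A E s r 2 := by
  rintro ⟨-, h⟩
  obtain ⟨f, -, h₁, h₂⟩ := h {0}
  exact absurd ((h₂ 1 (by simp)).trans (h₁ 0 (by simp))) hsr.not_ge

theorem isMuStable_of_forall_exists_atom {X : Type*} [MeasurableSpace X]
    [MeasurableSingletonClass X] (μ : Measure X) [IsFiniteMeasure μ]
    (h : ∀ E : Set X, 0 < μ E → ∃ p ∈ E, μ {p} ≠ 0) (A : Set (X → ℝ)) :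
    IsMuStable μ A := by
  rintro ⟨E, s, r, -, hE, hsr, hD⟩
  obtain ⟨p, hpE, hp⟩ := h E hE
  set ν := Measure.pi fun _ : Fin 2 => μ
  have hsub : stabilityWitness A E s r 2 ⊆
      (Set.univ.pi fun _ => E) \ {fun _ => p} := by
    intro w hw
    refine ⟨fun i _ => hw.1 i, ?_⟩
    rintro rfl
    exact const_notMem_stabilityWitness A E hsr p hw
  have hbox : ν (Set.univ.pi fun _ => E) = μ E ^ 2 := by simp [ν, Measure.pi_pi]
  have hpt : ν {fun _ => p} = μ {p} ^ 2 := by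
    rw [← Set.univ_pi_singleton]
    simp [ν, Measure.pi_pi]
  have hdiff : ν ((Set.univ.pi fun _ => E) \ {fun _ => p}) < μ E ^ 2 := by
    rw [measure_sdiff (by simpa [Set.singleton_subset_iff] using hpE)
      (measurableSet_singleton _).nullMeasurableSet (measure_ne_top _ _), hbox, hpt]
    exact ENNReal.sub_lt_self (by simp) (pow_ne_zero 2 hE.ne') (pow_ne_zero 2 hp)
  exact ((measure_mono hsub).trans_lt hdiff).ne (hD 2 one_le_two)

/-- Every purely atomic Borel probability measure on a compact Hausdorff space is
stable with respect to every pointwise bounded family of continuous functions. -/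
theorem purelyAtomic_isMuStable {X : Type*} [TopologicalSpace X] [CompactSpace X] [T2Space X]
    [MeasurableSpace X] [BorelSpace X] (μ : Measure X)
    (x : ℕ → X) (r : ℕ → ENNReal) (hr : ∀ n, r n ≤ 1) (hrsum : ∑' n, r n = 1)
    (hμ : μ = Measure.sum fun n => r n • Measure.dirac (x n))
    (A : Set (X → ℝ))
    (hAcont : ∀ f ∈ A, Continuous f)
    (hAbdd : ∀ y : X, ∃ C : ℝ, ∀ f ∈ A, |f y| ≤ C) :
    IsMuStable μ A := by
  have : IsProbabilityMeasure μ := ⟨by simp [hμ, Measure.sum_apply, hrsum]⟩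
  refine isMuStable_of_forall_exists_atom μ (fun E hE => ?_) A
  rw [hμ] at hE
  obtain ⟨n, hn, hx⟩ := exists_atom_mem_of_measure_pos hE
  refine ⟨x n, hx, ?_⟩
  have hle : r n ≤ μ {x n} := by
    rw [hμ]
    refine le_trans ?_ (Measure.le_sum_apply _ {x n})
    exact le_trans (by simp) (ENNReal.le_tsum n)
  exact fun h0 => hn (le_antisymm (h0 ▸ hle) bot_le)
end

section
/- Let X be a compact Hausdorff space, μ a complete Radon probability measure on X, and A a uniformly bounded, μ-stable family of continuous real-valued functions on X. Then every function g : X → ℝ lying in the closure, with respect to the topology of pointwise convergence on X, of the convex hull of A is μ-measurable. (This is the measure-theoretic content of the paper's Proposition that the fiber function of an M-finitely satisfiable measure is measurable with respect to any dependent measure.) -/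
open MeasureTheory Filter Topology

namespace StableFamily

open scoped ENNReal

universe u

section Link

variable {Z : Type u}

/-- The link of a point in a family of finite sequences. -/
def link (D : Set (List Z)) (z : Z) : Set (List Z) := {l | z :: l ∈ D}

/-- A family of finite sequences closed under passing to subsequences. -/
def Hereditary (D : Set (List Z)) : Prop := ∀ ⦃l l' : List Z⦄, l'.Sublist l → l ∈ D → l' ∈ D

theorem Hereditary.link {D : Set (List Z)} (hD : Hereditary D) (z : Z) :
    Hereditary (link D z) := fun _ _ h hl => hD (h.cons_cons z) hl

theorem Hereditary.link_subset {D : Set (List Z)} (hD : Hereditary D) (z : Z) :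
    StableFamily.link D z ⊆ D := fun _ hl => hD (List.sublist_cons_self _ _) hl

theorem link_mono {D D' : Set (List Z)} (h : D ⊆ D') (z : Z) : link D z ⊆ link D' z :=
  fun _ hl => h hl

/-- The sequences in `D` all of whose entries lie in `G`. -/
def within (D : Set (List Z)) (G : Set Z) : Set (List Z) := {l | l ∈ D ∧ ∀ z ∈ l, z ∈ G}

theorem Hereditary.within {D : Set (List Z)} (hD : Hereditary D) (G : Set Z) :
    Hereditary (within D G) :=
  fun _ _ h hl => ⟨hD h hl.1, fun z hz => hl.2 z (h.subset hz)⟩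

theorem within_subset (D : Set (List Z)) (G : Set Z) : within D G ⊆ D := fun _ h => h.1

theorem link_within_of_mem {D : Set (List Z)} {G : Set Z} {z : Z} (hz : z ∈ G) :
    link (within D G) z = within (link D z) G := by
  ext l; simp [link, within, hz]

end Link

section Mass

variable {Z : Type u} [MeasurableSpace Z]

/-- The iterated-integral mass of the length-`k` part of a family of finite sequences. -/
noncomputable def mass (μ : Measure Z) : ℕ → Set (List Z) → ℝ≥0∞
  | 0, D => D.indicator 1 []
  | k + 1, D => ∫⁻ z, mass μ k (link D z) ∂μ

/-- Joint measurability of a parametrised family of sets of finite sequences. -/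
def MeasurableFamily {T : Type u} [MeasurableSpace T] (D : T → Set (List Z)) : Prop :=
  ∀ k : ℕ, MeasurableSet {p : T × (Fin k → Z) | List.ofFn p.2 ∈ D p.1}

/-- Measurability of every length-`k` part of a set of finite sequences. -/
def MeasurableLists (D : Set (List Z)) : Prop :=
  ∀ k : ℕ, MeasurableSet {w : Fin k → Z | List.ofFn w ∈ D}

theorem measurable_finCons {T : Type*} [MeasurableSpace T] {n : ℕ} {f : T → Z}
    {g : T → Fin n → Z} (hf : Measurable f) (hg : Measurable g) :
    Measurable fun t => (Fin.cons (f t) (g t) : Fin (n + 1) → Z) := by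
  refine measurable_pi_lambda _ fun i => ?_
  refine Fin.cases ?_ (fun j => ?_) i
  · simpa using hf
  · simpa using measurable_pi_iff.1 hg j

theorem MeasurableFamily.comp {T T' : Type u} [MeasurableSpace T] [MeasurableSpace T']
    {D : T → Set (List Z)} (hD : MeasurableFamily D) {g : T' → T} (hg : Measurable g) :
    MeasurableFamily fun t => D (g t) := fun k =>
  ((hg.comp measurable_fst).prodMk measurable_snd) (hD k)

theorem MeasurableLists.const {T : Type u} [MeasurableSpace T] {D : Set (List Z)}
    (hD : MeasurableLists D) : MeasurableFamily fun _ : T => D := fun k => measurable_snd (hD k)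

theorem MeasurableFamily.apply {T : Type u} [MeasurableSpace T]
    {D : T → Set (List Z)} (hD : MeasurableFamily D) (t : T) : MeasurableLists (D t) := fun k =>
  measurable_prodMk_left (hD k)

theorem MeasurableFamily.link {T : Type u} [MeasurableSpace T]
    {D : T → Set (List Z)} (hD : MeasurableFamily D) :
    MeasurableFamily fun p : T × Z => link (D p.1) p.2 := fun k => by
  have h : Measurable fun q : (T × Z) × (Fin k → Z) =>
      (q.1.1, (Fin.cons q.1.2 q.2 : Fin (k + 1) → Z)) :=
    (measurable_fst.comp measurable_fst).prodMk
      (measurable_finCons (measurable_snd.comp measurable_fst) measurable_snd)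
  have := h (hD (k + 1))
  simpa [StableFamily.link, Set.preimage, List.ofFn_cons] using this

theorem MeasurableLists.family_link {D : Set (List Z)} (hD : MeasurableLists D) :
    MeasurableFamily (StableFamily.link D) :=
  (hD.const (T := PUnit.{u + 1})).link.comp
    (g := fun z : Z => (PUnit.unit, z)) measurable_prodMk_left

theorem MeasurableLists.link {D : Set (List Z)} (hD : MeasurableLists D) (z : Z) :
    MeasurableLists (link D z) := hD.family_link.apply z

theorem MeasurableLists.within {D : Set (List Z)} (hD : MeasurableLists D) {G : Set Z}
    (hG : MeasurableSet G) : MeasurableLists (within D G) := fun k => by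
  have : {w : Fin k → Z | List.ofFn w ∈ StableFamily.within D G} =
      {w | List.ofFn w ∈ D} ∩ ⋂ i, (fun w : Fin k → Z => w i) ⁻¹' G := by
    ext w; simp [StableFamily.within, List.mem_ofFn]
  rw [this]
  exact (hD k).inter (MeasurableSet.iInter fun i => measurable_pi_apply i hG)

theorem MeasurableLists.iInter {D : ℕ → Set (List Z)} (hD : ∀ n, MeasurableLists (D n)) :
    MeasurableLists (⋂ n, D n) := fun k => by
  have : {w : Fin k → Z | List.ofFn w ∈ ⋂ n, D n} = ⋂ n, {w | List.ofFn w ∈ D n} := by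
    ext w; simp
  rw [this]
  exact MeasurableSet.iInter fun n => hD n k

theorem mass_mono (μ : Measure Z) (k : ℕ) {D D' : Set (List Z)} (h : D ⊆ D') :
    mass μ k D ≤ mass μ k D' := by
  induction k generalizing D D' with
  | zero => exact Set.indicator_le_indicator_of_subset h (fun _ => zero_le) _
  | succ k ih => exact lintegral_mono fun z => ih (link_mono h z)

theorem mass_empty (μ : Measure Z) (k : ℕ) : mass μ k ∅ = 0 := by
  induction k with
  | zero => simp [mass]
  | succ k ih => simp [mass, link, ih]

theorem mass_le_one (μ : Measure Z) [IsProbabilityMeasure μ] (k : ℕ) (D : Set (List Z)) :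
    mass μ k D ≤ 1 := by
  induction k generalizing D with
  | zero => exact Set.indicator_le_self' (fun _ _ => zero_le) _
  | succ k ih => exact (lintegral_mono fun z => ih _).trans (by simp)

theorem mass_ne_top (μ : Measure Z) [IsProbabilityMeasure μ] (k : ℕ) (D : Set (List Z)) :
    mass μ k D ≠ ∞ := ((mass_le_one μ k D).trans_lt ENNReal.one_lt_top).ne

theorem mass_add_le (μ : Measure Z) [IsProbabilityMeasure μ] (m n : ℕ) {D : Set (List Z)}
    (hD : Hereditary D) : mass μ (m + n) D ≤ mass μ m D * mass μ n D := by
  suffices H : ∀ D' : Set (List Z), Hereditary D' → D' ⊆ D →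
      mass μ (m + n) D' ≤ mass μ m D' * mass μ n D from H D hD subset_rfl
  induction m with
  | zero =>
    intro D' hD' h
    by_cases h0 : [] ∈ D'
    · simpa [mass, h0] using mass_mono μ n h
    · have : D' = ∅ := Set.eq_empty_of_forall_notMem fun l hl => h0 (hD' (List.nil_sublist l) hl)
      simp [this, mass_empty]
  | succ m ih =>
    intro D' hD' h
    rw [show m + 1 + n = (m + n) + 1 by ring]
    simp only [mass]
    rw [← lintegral_mul_const' _ _ (mass_ne_top μ n D)]
    exact lintegral_mono fun z => ih _ (hD'.link z) ((hD'.link_subset z).trans h)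

theorem MeasurableFamily.measurable_mass {μ : Measure Z} [SFinite μ] {T : Type u}
    [MeasurableSpace T] {D : T → Set (List Z)} (hD : MeasurableFamily D) (k : ℕ) :
    Measurable fun t => mass μ k (D t) := by
  induction k generalizing T with
  | zero =>
    have h : MeasurableSet {t | [] ∈ D t} := by
      have : Measurable fun t : T => (t, (Fin.elim0 : Fin 0 → Z)) := measurable_prodMk_right
      simpa [Set.preimage] using this (hD 0)
    exact (measurable_one.indicator h : Measurable ({t | [] ∈ D t}.indicator (1 : T → ℝ≥0∞)))
  | succ k ih => exact (ih hD.link).lintegral_prod_right'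

theorem MeasurableLists.measurable_mass_link {μ : Measure Z} [SFinite μ] {D : Set (List Z)}
    (hD : MeasurableLists D) (k : ℕ) : Measurable fun z => mass μ k (StableFamily.link D z) :=
  hD.family_link.measurable_mass k

theorem mass_iInter (μ : Measure Z) [IsProbabilityMeasure μ] (k : ℕ) {D : ℕ → Set (List Z)}
    (hD : ∀ n, MeasurableLists (D n)) (hanti : Antitone D) :
    mass μ k (⋂ n, D n) = ⨅ n, mass μ k (D n) := by
  induction k generalizing D with
  | zero =>
    simp only [mass]
    by_cases h : [] ∈ ⋂ n, D n
    · have h' : ∀ n, [] ∈ D n := Set.mem_iInter.1 h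
      simp only [Set.indicator_of_mem h, Set.indicator_of_mem (h' _), Pi.one_apply, iInf_const]
    · obtain ⟨n, hn⟩ : ∃ n, [] ∉ D n := by simpa using h
      rw [Set.indicator_of_notMem h]
      refine le_antisymm (zero_le) ((iInf_le _ n).trans ?_)
      rw [Set.indicator_of_notMem hn]
  | succ k ih =>
    have hl : ∀ z, link (⋂ n, D n) z = ⋂ n, link (D n) z := fun z => by
      ext l; simp [link]
    simp only [mass, hl]
    rw [← lintegral_iInf (fun n => (hD n).measurable_mass_link k)
      (fun a b hab z => mass_mono μ k (link_mono (hanti hab) z)) (mass_ne_top μ (k + 1) (D 0))]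
    exact lintegral_congr fun z =>
      ih (fun n => (hD n).link z) fun a b hab => link_mono (hanti hab) z

end Mass

section Critical

variable {Z : Type u} [MeasurableSpace Z]

/-- A measurable hereditary family of sequences whose mass decays no faster than `c ^ k`. -/
structure IsFat (μ : Measure Z) (c : ℝ≥0∞) (D : Set (List Z)) : Prop where
  hereditary : Hereditary D
  measurable : MeasurableLists D
  le_mass : ∀ k, c ^ k ≤ mass μ k D

theorem IsFat.nil_mem {μ : Measure Z} {c : ℝ≥0∞} {D : Set (List Z)} (hD : IsFat μ c D) :
    [] ∈ D := by
  by_contra h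
  have := hD.le_mass 0
  simp [mass, h] at this

theorem IsFat.iInter {μ : Measure Z} [IsProbabilityMeasure μ] {c : ℝ≥0∞} {D : ℕ → Set (List Z)}
    (hD : ∀ n, IsFat μ c (D n)) (hanti : Antitone D) : IsFat μ c (⋂ n, D n) where
  hereditary := fun _ _ h hl => Set.mem_iInter.2 fun n =>
    (hD n).hereditary h (Set.mem_iInter.1 hl n)
  measurable := MeasurableLists.iInter fun n => (hD n).measurable
  le_mass := fun k => by
    rw [mass_iInter μ k (fun n => (hD n).measurable) hanti]
    exact le_iInf fun n => (hD n).le_mass k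

/-- A fat family that cannot be shrunk to a fat subfamily with fewer sequences of length one. -/
def IsCritical (μ : Measure Z) (c : ℝ≥0∞) (D : Set (List Z)) : Prop :=
  IsFat μ c D ∧ ∀ D' ⊆ D, IsFat μ c D' → mass μ 1 D ≤ mass μ 1 D'

theorem IsFat.exists_isCritical {μ : Measure Z} [IsProbabilityMeasure μ] {c : ℝ≥0∞}
    {D : Set (List Z)} (hD : IsFat μ c D) : ∃ D' ⊆ D, IsCritical μ c D' := by
  have step : ∀ (D : {D : Set (List Z) // IsFat μ c D}) (n : ℕ),
      ∃ D' : {D : Set (List Z) // IsFat μ c D}, D'.1 ⊆ D.1 ∧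
        ∀ D'' ⊆ D.1, IsFat μ c D'' → mass μ 1 D'.1 ≤ mass μ 1 D'' + ((n : ℝ≥0∞) + 1)⁻¹ := by
    intro D n
    set I := ⨅ D'' : {D'' : Set (List Z) // D'' ⊆ D.1 ∧ IsFat μ c D''}, mass μ 1 D''.1 with hI
    have hI1 : I ≠ ∞ :=
      ((iInf_le _ ⟨D.1, subset_rfl, D.2⟩).trans_lt (mass_ne_top μ 1 D.1).lt_top).ne
    have hlt : I < I + ((n : ℝ≥0∞) + 1)⁻¹ :=
      ENNReal.lt_add_right hI1 (by simp)
    obtain ⟨⟨D', hs, hf⟩, h⟩ := iInf_lt_iff.1 hlt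
    refine ⟨⟨D', hf⟩, hs, fun D'' hs'' hf'' => h.le.trans ?_⟩
    gcongr
    exact iInf_le (fun D'' : {D'' : Set (List Z) // D'' ⊆ D.1 ∧ IsFat μ c D''} => mass μ 1 D''.1)
      ⟨D'', hs'', hf''⟩
  choose next hnext hmin using step
  let E : ℕ → {D : Set (List Z) // IsFat μ c D} := fun n => Nat.rec ⟨D, hD⟩ (fun n D => next D n) n
  have hanti : Antitone fun n => (E n).1 := antitone_nat_of_succ_le fun n => hnext (E n) n
  refine ⟨⋂ n, (E n).1, Set.iInter_subset (fun n => (E n).1) 0,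
    IsFat.iInter (fun n => (E n).2) hanti, fun D' hs hf => ?_⟩
  refine ge_of_tendsto' (x := atTop) (f := fun n : ℕ => mass μ 1 D' + ((n : ℝ≥0∞) + 1)⁻¹) ?_ ?_
  · have : Tendsto (fun n : ℕ => ((n : ℝ≥0∞) + 1)⁻¹) atTop (𝓝 0) := by
      have := (tendsto_add_atTop_iff_nat 1).2 ENNReal.tendsto_inv_nat_nhds_zero
      simpa using this
    simpa using tendsto_const_nhds.add this
  · intro n
    exact (mass_mono μ 1 (Set.iInter_subset (fun n => (E n).1) (n + 1))).trans
      (hmin (E n) n D' (hs.trans (Set.iInter_subset (fun n => (E n).1) n)) hf)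

theorem mass_mul_pow_le (μ : Measure Z) [IsProbabilityMeasure μ] {D : Set (List Z)}
    (hD : Hereditary D) {a : ℝ≥0∞} (ha : a ≤ 1) {j : ℕ} (hj : mass μ j D ≤ a ^ j)
    (hj0 : j = 0 → mass μ 0 D = 0) (n : ℕ) : mass μ n D * a ^ j ≤ a ^ n := by
  induction n using Nat.strong_induction_on with
  | _ n ih =>
    rcases lt_or_ge n j with h | h
    · calc mass μ n D * a ^ j ≤ 1 * a ^ j := by gcongr; exact mass_le_one μ n D
        _ ≤ a ^ n := by rw [one_mul]; exact pow_le_pow_of_le_one zero_le ha h.le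
    · obtain ⟨i, rfl⟩ := Nat.exists_eq_add_of_le h
      rcases Nat.eq_zero_or_pos j with rfl | hpos
      · have := mass_add_le μ 0 i hD
        rw [hj0 rfl, zero_mul] at this
        rw [nonpos_iff_eq_zero.1 this]; simp
      · calc mass μ (j + i) D * a ^ j ≤ (mass μ j D * mass μ i D) * a ^ j := by
              gcongr; exact mass_add_le μ j i hD
          _ = mass μ j D * (mass μ i D * a ^ j) := mul_assoc _ _ _
          _ ≤ a ^ j * a ^ i := by gcongr; exact ih i (by omega)
          _ = a ^ (j + i) := (pow_add _ _ _).symm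

/-- Partial sums of the generating series of the masses. -/
noncomputable def massSum (μ : Measure Z) (b : ℝ≥0∞) (n : ℕ) (D : Set (List Z)) : ℝ≥0∞ :=
  ∑ k ∈ Finset.range n, b ^ k * mass μ k D

theorem massSum_mono (μ : Measure Z) (b : ℝ≥0∞) (n : ℕ) {D D' : Set (List Z)} (h : D ⊆ D') :
    massSum μ b n D ≤ massSum μ b n D' :=
  Finset.sum_le_sum fun k _ => by gcongr; exact mass_mono μ k h

theorem massSum_succ {μ : Measure Z} [SFinite μ] {b : ℝ≥0∞} {D : Set (List Z)}
    (hD : MeasurableLists D) (n : ℕ) :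
    massSum μ b (n + 1) D = mass μ 0 D + b * ∫⁻ z, massSum μ b n (link D z) ∂μ := by
  simp only [massSum]
  rw [Finset.sum_range_succ', add_comm, lintegral_finsetSum, Finset.mul_sum]
  · simp only [pow_zero, one_mul, pow_succ', mul_assoc]
    congr 1
    refine Finset.sum_congr rfl fun k _ => ?_
    rw [lintegral_const_mul _ (hD.measurable_mass_link k)]
    rfl
  · exact fun k _ => (hD.measurable_mass_link k).const_mul _

theorem massSum_le_within {μ : Measure Z} [IsProbabilityMeasure μ] {b M : ℝ≥0∞} {G : Set Z}
    (hG : MeasurableSet G) {D : Set (List Z)} (hM : ∀ n, ∀ z ∉ G, massSum μ b n (link D z) ≤ M)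
    (n : ℕ) {D' : Set (List Z)} (hD' : Hereditary D') (hm : MeasurableLists D') (hsub : D' ⊆ D) :
    massSum μ b n D' ≤ (1 + b * M) * massSum μ b n (within D' G) := by
  induction n generalizing D' with
  | zero => simp [massSum]
  | succ n ih =>
    by_cases h0 : [] ∈ D'
    swap
    · have : D' = ∅ := Set.eq_empty_of_forall_notMem fun l hl => h0 (hD' (List.nil_sublist l) hl)
      simp [this, massSum, mass_empty]
    rw [massSum_succ hm, massSum_succ (hm.within hG), ← lintegral_add_compl _ hG,
      ← lintegral_add_compl (fun z => massSum μ b n (link (within D' G) z)) hG]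
    have e1 : mass μ 0 D' = 1 := by simp [mass, h0]
    have e2 : mass μ 0 (within D' G) = 1 := by simp [mass, within, h0]
    have i1 : ∫⁻ z in G, massSum μ b n (link D' z) ∂μ ≤
        (1 + b * M) * ∫⁻ z in G, massSum μ b n (link (within D' G) z) ∂μ := by
      rw [← lintegral_const_mul]
      · refine setLIntegral_mono' hG fun z hz => ?_
        rw [link_within_of_mem hz]
        exact ih (hD'.link z) (hm.link z) ((hD'.link_subset z).trans hsub)
      · exact Finset.measurable_sum _ fun k _ =>
          ((hm.within hG).measurable_mass_link k).const_mul _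
    have i2 : ∫⁻ z in Gᶜ, massSum μ b n (link D' z) ∂μ ≤ M := by
      calc ∫⁻ z in Gᶜ, massSum μ b n (link D' z) ∂μ ≤ ∫⁻ z in Gᶜ, M ∂μ :=
            setLIntegral_mono' hG.compl fun z hz =>
              (massSum_mono μ b n (link_mono hsub z)).trans (hM n z hz)
        _ ≤ M * 1 := by
            rw [setLIntegral_const]; gcongr; exact prob_le_one
        _ = M := mul_one M
    rw [e1, e2]
    set A := ∫⁻ z in G, massSum μ b n (link (within D' G) z) ∂μ
    calc 1 + b * (∫⁻ z in G, massSum μ b n (link D' z) ∂μ +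
          ∫⁻ z in Gᶜ, massSum μ b n (link D' z) ∂μ)
        ≤ 1 + b * ((1 + b * M) * A + M) := by gcongr
      _ = (1 + b * M) * (1 + b * A) := by ring
      _ ≤ _ := by gcongr; exact le_self_add

theorem IsFat.within_link {μ : Measure Z} [IsProbabilityMeasure μ] {c : ℝ≥0∞} (hc0 : c ≠ 0)
    (hc1 : c ≤ 1) {D : Set (List Z)} (hD : IsFat μ c D) :
    IsFat μ c (within D {z | IsFat μ c (link D z)}) := by
  set G := {z | IsFat μ c (link D z)} with hGdef
  have hctop : c ≠ ∞ := (hc1.trans_lt ENNReal.one_lt_top).ne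
  have hmem : ∀ z, z ∈ G ↔ ∀ k, c ^ k ≤ mass μ k (link D z) := fun z =>
    ⟨fun h => h.le_mass, fun h => ⟨hD.hereditary.link z, hD.measurable.link z, h⟩⟩
  obtain ⟨a, hamono, halt, hatends⟩ : ∃ a : ℕ → ℝ≥0∞, StrictMono a ∧ (∀ n, a n < c) ∧
      Tendsto a atTop (𝓝 c) := by
    obtain ⟨a, h1, h2, h3⟩ := exists_seq_strictMono_tendsto' (pos_iff_ne_zero.2 hc0)
    exact ⟨a, h1, fun n => (h2 n).2, h3⟩
  let H : ℕ → Set Z := fun m => {z | ∀ j ≤ m, a m ^ j ≤ mass μ j (link D z)}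
  have hHm : ∀ m, MeasurableSet (H m) := fun m => by
    simp only [H, Set.ofPred_forall]
    exact MeasurableSet.iInter fun j => MeasurableSet.iInter fun _ =>
      measurableSet_le measurable_const (hD.measurable.measurable_mass_link j)
  have hHanti : Antitone H := fun m m' h z hz j hj =>
    (pow_le_pow_left₀ zero_le (hamono.monotone h) j).trans (hz j (hj.trans h))
  have hGH : G = ⋂ m, H m := by
    ext z
    rw [hmem, Set.mem_iInter]
    refine ⟨fun h m j _ => (pow_le_pow_left₀ zero_le (halt m).le j).trans (h j), fun h k => ?_⟩
    refine le_of_tendsto (ENNReal.Tendsto.pow hatends) ?_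
    filter_upwards [eventually_ge_atTop k] with m hm using h m k hm
  have hGm : MeasurableSet G := hGH ▸ MeasurableSet.iInter hHm
  refine ⟨hD.hereditary.within G, hD.measurable.within hGm, ?_⟩
  by_contra! hcon
  obtain ⟨k, hk⟩ := hcon
  have hw : within D G = ⋂ m, within D (H m) := by
    ext l
    simp only [within, hGH, Set.mem_iInter, Set.mem_ofPred_eq]
    exact ⟨fun h m => ⟨h.1, fun z hz => h.2 z hz m⟩,
      fun h => ⟨(h 0).1, fun z hz m => (h m).2 z hz⟩⟩
  have hwanti : Antitone fun m => within D (H m) := fun m m' h l hl =>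
    ⟨hl.1, fun z hz => hHanti h (hl.2 z hz)⟩
  have hlim : Tendsto (fun m => mass μ k (within D (H m))) atTop (𝓝 (mass μ k (within D G))) := by
    rw [hw, mass_iInter μ k (fun m => hD.measurable.within (hHm m)) hwanti]
    exact tendsto_atTop_iInf fun m m' h => mass_mono μ k (hwanti h)
  obtain ⟨m, hmk, hm0⟩ := ((hlim.eventually_lt (ENNReal.Tendsto.pow (n := k) hatends) hk).and
    (hatends.eventually_ne hc0)).exists
  set α := a m
  have hα1 : α ≤ 1 := (halt m).le.trans hc1
  have hαtop : α ≠ ∞ := (hα1.trans_lt ENNReal.one_lt_top).ne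
  set b := c⁻¹
  have hbtop : b ≠ ∞ := ENNReal.inv_ne_top.2 hc0
  set ρ := b * α
  have hρ : ρ < 1 := by
    have : ρ < b * c :=
      (ENNReal.mul_lt_mul_iff_right (ENNReal.inv_ne_zero.2 hctop) hbtop).2 (halt m)
    rwa [ENNReal.inv_mul_cancel hc0 hctop] at this
  have hbound : ∀ D' : Set (List Z), Hereditary D' → ∀ j, mass μ j D' < α ^ j →
      ∀ n, massSum μ b n D' ≤ (α ^ j)⁻¹ * (1 - ρ)⁻¹ := by
    intro D' hD' j hj n
    have key : ∀ i, mass μ i D' ≤ (α ^ j)⁻¹ * α ^ i := fun i => by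
      have := mass_mul_pow_le μ hD' hα1 hj.le (fun h0 => by
        subst h0
        by_cases h : [] ∈ D' <;> simp [mass, h] at hj ⊢) i
      rw [← ENNReal.div_eq_inv_mul]
      exact (ENNReal.le_div_iff_mul_le (Or.inl (pow_ne_zero _ hm0))
        (Or.inl (ENNReal.pow_ne_top hαtop))).2 this
    calc massSum μ b n D' ≤ ∑ i ∈ Finset.range n, (α ^ j)⁻¹ * ρ ^ i := by
          refine Finset.sum_le_sum fun i _ => ?_
          calc b ^ i * mass μ i D' ≤ b ^ i * ((α ^ j)⁻¹ * α ^ i) := by gcongr; exact key i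
            _ = (α ^ j)⁻¹ * ρ ^ i := by simp only [ρ, mul_pow]; ring
      _ = (α ^ j)⁻¹ * ∑ i ∈ Finset.range n, ρ ^ i := by rw [Finset.mul_sum]
      _ ≤ (α ^ j)⁻¹ * (1 - ρ)⁻¹ := by
          rw [← ENNReal.tsum_geometric]; gcongr; exact ENNReal.sum_le_tsum _
  set C := fun j => (α ^ j)⁻¹ * (1 - ρ)⁻¹
  have hC : ∀ j, C j ≠ ∞ := fun j => ENNReal.mul_ne_top
    (ENNReal.inv_ne_top.2 (pow_ne_zero _ hm0)) (ENNReal.inv_ne_top.2 (tsub_pos_of_lt hρ).ne')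
  have hM : ∀ n, ∀ z ∉ H m, massSum μ b n (link D z) ≤ C m := by
    intro n z hz
    simp only [H, Set.mem_ofPred_eq, not_forall, not_le] at hz
    obtain ⟨j, hj, hlt⟩ := hz
    refine (hbound _ (hD.hereditary.link z) j hlt n).trans ?_
    have : (α ^ j)⁻¹ ≤ (α ^ m)⁻¹ := ENNReal.inv_le_inv.2 (pow_le_pow_of_le_one zero_le hα1 hj)
    simp only [C]
    gcongr
  have hfin : (1 + b * C m) * C k ≠ ∞ := ENNReal.mul_ne_top
    (ENNReal.add_ne_top.2 ⟨ENNReal.one_ne_top, ENNReal.mul_ne_top hbtop (hC m)⟩) (hC k)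
  obtain ⟨n, hn⟩ := ENNReal.exists_nat_gt hfin
  refine absurd hn (not_lt.2 ?_)
  calc (n : ℝ≥0∞) = ∑ i ∈ Finset.range n, b ^ i * c ^ i := by
        simp only [← mul_pow, b, ENNReal.inv_mul_cancel hc0 hctop]; simp
    _ ≤ massSum μ b n D := Finset.sum_le_sum fun i _ => by gcongr; exact hD.le_mass i
    _ ≤ (1 + b * C m) * massSum μ b n (within D (H m)) :=
        massSum_le_within (hHm m) hM n hD.hereditary hD.measurable subset_rfl
    _ ≤ (1 + b * C m) * C k := by
        gcongr; exact hbound _ (hD.hereditary.within _) k hmk n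

/-- Almost every sequence of `k` points of `E`, chosen one at a time, belongs to `D`. -/
def AEFull (μ : Measure Z) (E : Set Z) : ℕ → Set (List Z) → Prop
  | 0, D => [] ∈ D
  | k + 1, D => ∀ᵐ z ∂μ, z ∈ E → AEFull μ E k (link D z)

theorem AEFull.mono {μ : Measure Z} {E : Set Z} {k : ℕ} {D D' : Set (List Z)} (h : D ⊆ D')
    (hD : AEFull μ E k D) : AEFull μ E k D' := by
  induction k generalizing D D' with
  | zero => exact h hD
  | succ k ih =>
    filter_upwards [show ∀ᵐ z ∂μ, z ∈ E → AEFull μ E k (link D z) from hD] with z hz hE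
    exact ih (link_mono h z) (hz hE)

theorem MeasurableLists.measurableSet_singleton {D : Set (List Z)} (hD : MeasurableLists D) :
    MeasurableSet {z | [z] ∈ D} := by
  have : Measurable fun z : Z => (fun _ : Fin 1 => z) :=
    measurable_pi_lambda _ fun _ => measurable_id
  simpa [Set.preimage] using this (hD 1)

theorem MeasurableLists.mass_one {μ : Measure Z} {D : Set (List Z)} (hD : MeasurableLists D) :
    mass μ 1 D = μ {z | [z] ∈ D} := by
  rw [← lintegral_indicator_one hD.measurableSet_singleton]
  rfl

theorem IsCritical.of_subset {μ : Measure Z} {c : ℝ≥0∞} {D D' : Set (List Z)}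
    (hD : IsCritical μ c D) (hs : D' ⊆ D) (hD' : IsFat μ c D') : IsCritical μ c D' :=
  ⟨hD', fun D'' hs' h => (mass_mono μ 1 hs).trans (hD.2 D'' (hs'.trans hs) h)⟩

theorem IsCritical.ae_singleton_mem {μ : Measure Z} [IsProbabilityMeasure μ] {c : ℝ≥0∞}
    {D D' : Set (List Z)} (hD : IsCritical μ c D) (hs : D' ⊆ D) (hD' : IsFat μ c D') :
    ∀ᵐ z ∂μ, [z] ∈ D → [z] ∈ D' := by
  have hsub : {z | [z] ∈ D'} ⊆ {z | [z] ∈ D} := fun z hz => hs hz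
  have hle := hD.2 D' hs hD'
  rw [hD.1.measurable.mass_one, hD'.measurable.mass_one] at hle
  have := ae_eq_of_subset_of_measure_ge hsub hle
    hD'.measurable.measurableSet_singleton.nullMeasurableSet (measure_ne_top _ _)
  filter_upwards [this.mem_iff] with z hz h using hz.2 h

theorem IsCritical.aeFull {μ : Measure Z} [IsProbabilityMeasure μ] {c : ℝ≥0∞} (hc0 : c ≠ 0)
    (hc1 : c ≤ 1) {E : Set Z} (k : ℕ) {D : Set (List Z)} (hD : IsCritical μ c D)
    (hE : ∀ᵐ z ∂μ, z ∈ E → [z] ∈ D) : AEFull μ E k D := by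
  induction k generalizing D with
  | zero => exact hD.1.nil_mem
  | succ k ih =>
    filter_upwards [hE, hD.ae_singleton_mem (within_subset _ _) (hD.1.within_link hc0 hc1)]
      with z hz hz' hzE
    have hfat : IsFat μ c (link D z) := (hz' (hz hzE)).2 z (by simp)
    have hs := hD.1.hereditary.link_subset z
    refine ih (hD.of_subset hs hfat) ?_
    filter_upwards [hE, hD.ae_singleton_mem hs hfat] with y hy hy' hyE using hy' (hy hyE)

/-- A fat family contains almost all sequences from some set of positive measure. -/
theorem IsFat.exists_aeFull {μ : Measure Z} [IsProbabilityMeasure μ] {c : ℝ≥0∞} (hc0 : c ≠ 0)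
    (hc1 : c ≤ 1) {D : Set (List Z)} (hD : IsFat μ c D) :
    ∃ E : Set Z, MeasurableSet E ∧ μ E ≠ 0 ∧ ∀ k, AEFull μ E k D := by
  obtain ⟨D', hs, hD'⟩ := hD.exists_isCritical
  refine ⟨{z | [z] ∈ D'}, hD'.1.measurable.measurableSet_singleton, ?_,
    fun k => (hD'.aeFull hc0 hc1 k (Eventually.of_forall fun z hz => hz)).mono hs⟩
  rw [← hD'.1.measurable.mass_one]
  have := hD'.1.le_mass 1
  rw [pow_one] at this
  exact fun h => hc0 (nonpos_iff_eq_zero.1 (h ▸ this))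

end Critical

section Shattering

/-- The real functions `V σ`, `σ ∈ S`, realise every above/below pattern on the domain of the
partial function `τ`, where `τ i = some j` requires a crossing of the gap from `lo j` to `hi j`. -/
def Shatters {σ : Type*} {n N : ℕ} (lo hi : Fin N → ℝ) (V : σ → Fin n → ℝ) (S : Set σ)
    (τ : Fin n → Option (Fin N)) : Prop :=
  ∀ b : Fin n → Bool, ∃ s ∈ S, ∀ i j, τ i = some j →
    if b i then hi j ≤ V s i else V s i ≤ lo j

theorem Shatters.mono {σ : Type*} {n N : ℕ} {lo hi : Fin N → ℝ} {V : σ → Fin n → ℝ} {S S' : Set σ}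
    (h : S ⊆ S') {τ : Fin n → Option (Fin N)} (hS : Shatters lo hi V S τ) :
    Shatters lo hi V S' τ := fun b =>
  let ⟨s, hs, H⟩ := hS b
  ⟨s, h hs, H⟩

open Classical in
/-- The finite set of all shattered gap assignments. -/
noncomputable def shattered {σ : Type*} {n N : ℕ} (lo hi : Fin N → ℝ) (V : σ → Fin n → ℝ)
    (S : Set σ) : Finset (Fin n → Option (Fin N)) :=
  Finset.univ.filter fun τ => Shatters lo hi V S τ

open Classical in
theorem card_shattered_add_le {σ : Type*} {n N : ℕ} {lo hi : Fin N → ℝ} (hlt : ∀ j, lo j < hi j)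
    {V : σ → Fin n → ℝ} {S S₁ S₂ : Set σ} (h₁ : S₁ ⊆ S) (h₂ : S₂ ⊆ S) (i₀ : Fin n) (j₀ : Fin N)
    (hS₁ : ∀ s ∈ S₁, hi j₀ ≤ V s i₀) (hS₂ : ∀ s ∈ S₂, V s i₀ ≤ lo j₀) :
    (shattered lo hi V S₁).card + (shattered lo hi V S₂).card ≤ (shattered lo hi V S).card := by
  set F₁ := shattered lo hi V S₁
  set F₂ := shattered lo hi V S₂
  have m₁ : ∀ τ, τ ∈ F₁ ↔ Shatters lo hi V S₁ τ := fun τ => by simp [F₁, shattered]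
  have m₂ : ∀ τ, τ ∈ F₂ ↔ Shatters lo hi V S₂ τ := fun τ => by simp [F₂, shattered]
  have low : ∀ τ, τ ∈ F₁ → ∀ j, τ i₀ = some j → hi j₀ ≤ lo j := fun τ hτ j hj => by
    obtain ⟨s, hs, H⟩ := (m₁ τ).1 hτ fun _ => false
    exact (hS₁ s hs).trans (by simpa using H i₀ j hj)
  have high : ∀ τ, τ ∈ F₂ → ∀ j, τ i₀ = some j → hi j ≤ lo j₀ := fun τ hτ j hj => by
    obtain ⟨s, hs, H⟩ := (m₂ τ).1 hτ fun _ => true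
    exact le_trans (by simpa using H i₀ j hj) (hS₂ s hs)
  have hnone : ∀ τ ∈ F₁ ∩ F₂, τ i₀ = none := fun τ hτ => by
    rw [Finset.mem_inter] at hτ
    cases hj : τ i₀ with
    | none => rfl
    | some j => linarith [low τ hτ.1 j hj, high τ hτ.2 j hj, hlt j, hlt j₀]
  let u : (Fin n → Option (Fin N)) → Fin n → Option (Fin N) :=
    fun τ => Function.update τ i₀ (some j₀)
  have hinj : Set.InjOn u (F₁ ∩ F₂ : Finset _) := fun τ hτ τ' hτ' h => by
    funext i
    by_cases hi : i = i₀
    · rw [hi, hnone τ hτ, hnone τ' hτ']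
    · simpa [u, hi] using congrFun h i
  have hdisj : Disjoint (F₁ ∪ F₂) ((F₁ ∩ F₂).image u) := by
    rw [Finset.disjoint_right]
    intro τ hτ
    obtain ⟨τ', -, rfl⟩ := Finset.mem_image.1 hτ
    rw [Finset.mem_union, not_or]
    exact ⟨fun h => by linarith [low _ h j₀ (by simp [u]), hlt j₀],
      fun h => by linarith [high _ h j₀ (by simp [u]), hlt j₀]⟩
  have hsub : (F₁ ∪ F₂) ∪ (F₁ ∩ F₂).image u ⊆ shattered lo hi V S := by
    intro τ hτ
    simp only [shattered, Finset.mem_filter, Finset.mem_univ, true_and]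
    rw [Finset.mem_union, Finset.mem_union] at hτ
    rcases hτ with (h | h) | h
    · exact ((m₁ τ).1 h).mono h₁
    · exact ((m₂ τ).1 h).mono h₂
    · obtain ⟨τ', hτ', rfl⟩ := Finset.mem_image.1 h
      rw [Finset.mem_inter, m₁, m₂] at hτ'
      intro b
      cases hb : b i₀ with
      | true =>
        obtain ⟨s, hs, H⟩ := hτ'.1 b
        refine ⟨s, h₁ hs, fun i j hij => ?_⟩
        by_cases hi : i = i₀
        · subst hi
          obtain rfl : j₀ = j := by simpa [u] using hij
          simpa [hb] using hS₁ s hs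
        · exact H i j (by simpa [u, hi] using hij)
      | false =>
        obtain ⟨s, hs, H⟩ := hτ'.2 b
        refine ⟨s, h₂ hs, fun i j hij => ?_⟩
        by_cases hi : i = i₀
        · subst hi
          obtain rfl : j₀ = j := by simpa [u] using hij
          simpa [hb] using hS₂ s hs
        · exact H i j (by simpa [u, hi] using hij)
  calc F₁.card + F₂.card = (F₁ ∪ F₂).card + (F₁ ∩ F₂).card :=
        (Finset.card_union_add_card_inter _ _).symm
    _ = (F₁ ∪ F₂).card + ((F₁ ∩ F₂).image u).card := by rw [Finset.card_image_of_injOn hinj]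
    _ = ((F₁ ∪ F₂) ∪ (F₁ ∩ F₂).image u).card := (Finset.card_union_of_disjoint hdisj).symm
    _ ≤ _ := Finset.card_le_card hsub

theorem two_pow_le_card_shattered {σ : Type*} {n N : ℕ} {lo hi : Fin N → ℝ}
    (hlt : ∀ j, lo j < hi j) {V : σ → Fin n → ℝ} {T α : ℝ} (hT : 0 < T) (hα0 : 0 ≤ α) (hα1 : α ≤ 1)
    (split : ∀ S : Finset σ, T ≤ S.card → ∃ i j, ∃ S₁ ⊆ S, ∃ S₂ ⊆ S,
      (∀ s ∈ S₁, hi j ≤ V s i) ∧ (∀ s ∈ S₂, V s i ≤ lo j) ∧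
      α * S.card ≤ S₁.card ∧ α * S.card ≤ S₂.card)
    (d : ℕ) (S : Finset σ) (hS : T ≤ S.card * α ^ d) :
    2 ^ d ≤ (shattered lo hi V (S : Set σ)).card := by
  induction d generalizing S with
  | zero =>
    obtain ⟨s, hs⟩ : S.Nonempty := by
      rw [← Finset.card_pos]
      have : (0 : ℝ) < S.card := hT.trans_le (by simpa using hS)
      exact_mod_cast this
    rw [pow_zero, Nat.one_le_iff_ne_zero, ← Nat.pos_iff_ne_zero, Finset.card_pos]
    refine ⟨fun _ => none, ?_⟩
    simp only [shattered, Finset.mem_filter, Finset.mem_univ, true_and]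
    exact fun b => ⟨s, hs, by simp⟩
  | succ d ih =>
    have hpow : α ^ (d + 1) ≤ 1 := pow_le_one₀ hα0 hα1
    obtain ⟨i, j, S₁, h₁, S₂, h₂, H₁, H₂, c₁, c₂⟩ := split S (hS.trans (by
      nlinarith [(Nat.cast_nonneg S.card : (0 : ℝ) ≤ S.card)]))
    have e : ∀ S' : Finset σ, α * S.card ≤ S'.card → T ≤ S'.card * α ^ d := fun S' h =>
      hS.trans (by
        rw [pow_succ', ← mul_assoc, mul_comm (S.card : ℝ)]
        gcongr)
    have := card_shattered_add_le (V := V) hlt (S := (S : Set σ)) (by exact_mod_cast h₁)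
      (by exact_mod_cast h₂) i j H₁ H₂
    have := ih S₁ (e S₁ c₁)
    have := ih S₂ (e S₂ c₂)
    rw [pow_succ]
    omega

/-- The sign attached to a Boolean. -/
def boolSign (b : Bool) : ℝ := if b then 1 else -1

theorem abs_boolSign (b : Bool) : |boolSign b| = 1 := by cases b <;> simp [boolSign]

theorem sum_exp_boolSign_le {n : ℕ} {a : Fin n → ℝ} (ha : ∀ i, |a i| ≤ 1) (l : ℝ) :
    ∑ s : Fin n → Bool, Real.exp (l * ∑ i, a i * boolSign (s i)) ≤
      2 ^ n * Real.exp (l ^ 2 / 2 * n) := by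
  have h1 : ∀ s : Fin n → Bool, Real.exp (l * ∑ i, a i * boolSign (s i)) =
      ∏ i, Real.exp (l * (a i * boolSign (s i))) := fun s => by
    rw [Finset.mul_sum, Real.exp_sum]
  simp_rw [h1]
  rw [← Fintype.piFinset_univ,
    ← Finset.prod_univ_sum (fun _ => Finset.univ) fun i b => Real.exp (l * (a i * boolSign b))]
  have h2 : ∀ i, ∑ b : Bool, Real.exp (l * (a i * boolSign b)) ≤ 2 * Real.exp (l ^ 2 / 2) := by
    intro i
    have e : ∑ b : Bool, Real.exp (l * (a i * boolSign b)) = 2 * Real.cosh (l * a i) := by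
      rw [Real.cosh_eq]; simp [boolSign]; ring
    rw [e]
    gcongr
    refine (Real.cosh_le_exp_half_sq _).trans (Real.exp_le_exp.2 ?_)
    rw [mul_pow]
    have : a i ^ 2 ≤ 1 := (sq_le_one_iff_abs_le_one _).2 (ha i)
    nlinarith [sq_nonneg l]
  calc ∏ i, ∑ b : Bool, Real.exp (l * (a i * boolSign b))
      ≤ ∏ _i : Fin n, 2 * Real.exp (l ^ 2 / 2) :=
        Finset.prod_le_prod (fun i _ => Finset.sum_nonneg fun _ _ => (Real.exp_pos _).le)
          fun i _ => h2 i
    _ = 2 ^ n * Real.exp (l ^ 2 / 2 * n) := by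
        rw [Finset.prod_const, Finset.card_univ, Fintype.card_fin, mul_pow, ← Real.exp_nat_mul,
          mul_comm (n : ℝ)]

theorem sum_boolSign_le {n : ℕ} {a : Fin n → ℝ} (ha : ∀ i, |a i| ≤ 1) {δ : ℝ} (hδ : 0 < δ)
    {S : Finset (Fin n → Bool)} (hS : 2 ^ n * Real.exp (-(δ ^ 2 / 32 * n)) ≤ S.card) :
    ∑ s ∈ S, ∑ i, a i * boolSign (s i) ≤ δ / 4 * n * S.card := by
  set Y : (Fin n → Bool) → ℝ := fun s => ∑ i, a i * boolSign (s i)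
  have h1 : ∑ s ∈ S, (δ / 4 * (Y s - δ / 4 * n) + 1) ≤ S.card := by
    calc ∑ s ∈ S, (δ / 4 * (Y s - δ / 4 * n) + 1)
        ≤ ∑ s ∈ S, Real.exp (δ / 4 * Y s) * Real.exp (-(δ ^ 2 / 16 * n)) := by
          refine Finset.sum_le_sum fun s _ => ?_
          rw [← Real.exp_add]
          refine (Real.add_one_le_exp _).trans (le_of_eq ?_)
          congr 1; ring
      _ ≤ ∑ s, Real.exp (δ / 4 * Y s) * Real.exp (-(δ ^ 2 / 16 * n)) :=
          Finset.sum_le_univ_sum_of_nonneg fun s => by positivity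
      _ ≤ (2 ^ n * Real.exp ((δ / 4) ^ 2 / 2 * n)) * Real.exp (-(δ ^ 2 / 16 * n)) := by
          rw [← Finset.sum_mul]
          gcongr
          exact sum_exp_boolSign_le ha _
      _ = 2 ^ n * Real.exp (-(δ ^ 2 / 32 * n)) := by
          rw [mul_assoc, ← Real.exp_add]; congr 2; ring
      _ ≤ _ := hS
  rw [Finset.sum_add_distrib, ← Finset.mul_sum, Finset.sum_sub_distrib] at h1
  simp only [Finset.sum_const, nsmul_eq_mul, mul_one] at h1
  have h2 : δ / 4 * (∑ s ∈ S, Y s - S.card * (δ / 4 * n)) ≤ 0 := by linarith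
  have h3 := nonpos_of_mul_nonpos_right h2 (by positivity)
  linarith

/-- The points of the uniform grid of mesh `2 / N` on `[-1, 1]`. -/
noncomputable def grid (N j : ℕ) : ℝ := -1 + 2 * j / N

theorem exists_concentration {σ : Type*} {N : ℕ} (hN : 0 < N) {v : σ → ℝ} (hv : ∀ s, |v s| ≤ 1)
    {α : ℝ} (hα : 0 ≤ α) (hα1 : α ≤ 1) (S : Finset σ)
    (h : ∀ j < N, α * S.card ≤ (S.filter fun s => v s ≤ grid N j).card →
      ((S.filter fun s => grid N (j + 1) ≤ v s).card : ℝ) ≤ α * S.card) :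
    ∃ a, |a| ≤ 1 ∧ ((S.filter fun s => 2 / (N : ℝ) < |v s - a|).card : ℝ) ≤ 2 * α * S.card := by
  classical
  have hN' : (0 : ℝ) < N := by exact_mod_cast hN
  have hp : ∃ j, α * S.card ≤ (S.filter fun s => v s ≤ grid N j).card := by
    refine ⟨N, ?_⟩
    rw [Finset.filter_true_of_mem]
    · nlinarith [(Nat.cast_nonneg S.card : (0 : ℝ) ≤ S.card)]
    · intro s _
      have : grid N N = 1 := by unfold grid; field_simp; norm_num
      rw [this]; exact (abs_le.1 (hv s)).2
  have hjN : Nat.find hp ≤ N := Nat.find_min' hp (by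
    rw [Finset.filter_true_of_mem]
    · nlinarith [(Nat.cast_nonneg S.card : (0 : ℝ) ≤ S.card)]
    · intro s _
      have : grid N N = 1 := by unfold grid; field_simp; norm_num
      rw [this]; exact (abs_le.1 (hv s)).2)
  have hspec := Nat.find_spec hp
  have hmin := fun m => Nat.find_min hp (m := m)
  generalize Nat.find hp = j at hjN hspec hmin
  have hjN' : (j : ℝ) ≤ N := by exact_mod_cast hjN
  have hSnn : 0 ≤ α * S.card := by positivity
  refine ⟨grid N j, ?_, ?_⟩
  · have : (j : ℝ) / N ≤ 1 := (div_le_one hN').2 hjN'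
    have : (0 : ℝ) ≤ (j : ℝ) / N := by positivity
    rw [abs_le, grid, mul_div_assoc]
    constructor <;> linarith
  have hup : ((S.filter fun s => grid N j + 2 / N < v s).card : ℝ) ≤ α * S.card := by
    rcases hjN.lt_or_eq with hlt | rfl
    · refine le_trans ?_ (h j hlt hspec)
      gcongr with s _
      intro hs
      refine le_trans (le_of_eq ?_) hs.le
      simp only [grid]; push_cast; ring
    · rw [Finset.filter_false_of_mem]
      · simpa using hSnn
      · intro s _ hs
        have : grid j j = 1 := by unfold grid; field_simp; norm_num
        rw [this] at hs
        have : 0 < 2 / (j : ℝ) := by positivity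
        linarith [(abs_le.1 (hv s)).2]
  have hdown : ((S.filter fun s => v s < grid N j - 2 / N).card : ℝ) ≤ α * S.card := by
    rcases Nat.eq_zero_or_pos j with rfl | hpos
    · rw [Finset.filter_false_of_mem]
      · simpa using hSnn
      · intro s _ hs
        have : 0 < 2 / (N : ℝ) := by positivity
        simp only [grid, Nat.cast_zero, mul_zero, zero_div, add_zero] at hs
        linarith [(abs_le.1 (hv s)).1]
    · refine le_trans ?_ (not_le.1 (hmin (j - 1) (by omega))).le
      gcongr with s _
      intro hs
      refine hs.le.trans (le_of_eq ?_)
      simp only [grid]; push_cast [Nat.cast_sub hpos]; ring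
  have hsub : (S.filter fun s => 2 / (N : ℝ) < |v s - grid N j|) ⊆
      (S.filter fun s => grid N j + 2 / N < v s) ∪ S.filter fun s => v s < grid N j - 2 / N := by
    intro s hs
    simp only [Finset.mem_union, Finset.mem_filter] at hs ⊢
    rcases lt_abs.1 hs.2 with h' | h'
    · exact Or.inl ⟨hs.1, by linarith⟩
    · exact Or.inr ⟨hs.1, by linarith⟩
  have hc : ((S.filter fun s => 2 / (N : ℝ) < |v s - grid N j|).card : ℝ) ≤
      (S.filter fun s => grid N j + 2 / N < v s).card +
        (S.filter fun s => v s < grid N j - 2 / N).card := by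
    exact_mod_cast (Finset.card_le_card hsub).trans (Finset.card_union_le _ _)
  linarith

theorem sum_boolSign_mul_le {n : ℕ} {v : (Fin n → Bool) → ℝ} {i : Fin n} {S : Finset (Fin n → Bool)}
    (hv : ∀ s, |v s| ≤ 1) {a ε β : ℝ} (ha : |a| ≤ 1) (hε : 0 ≤ ε)
    (h : ((S.filter fun s => ε < |v s - a|).card : ℝ) ≤ β * S.card) :
    ∑ s ∈ S, boolSign (s i) * v s ≤ ∑ s ∈ S, a * boolSign (s i) + (ε + 2 * β) * S.card := by
  have h1 : ∀ s ∈ S, boolSign (s i) * v s ≤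
      a * boolSign (s i) + (ε + if ε < |v s - a| then 2 else 0) := by
    intro s _
    have e1 : boolSign (s i) * (v s - a) ≤ |v s - a| := by
      refine (le_abs_self _).trans ?_
      rw [abs_mul, abs_boolSign, one_mul]
    have e2 : |v s - a| ≤ 2 := (abs_sub _ _).trans (by linarith [hv s])
    split_ifs with hs
    · linarith
    · linarith
  refine (Finset.sum_le_sum h1).trans ?_
  rw [Finset.sum_add_distrib, Finset.sum_add_distrib, ← Finset.sum_filter]
  simp only [Finset.sum_const, nsmul_eq_mul]
  linarith

theorem exists_split_of_correlated {δ : ℝ} (hδ : 0 < δ) (hδ1 : δ ≤ 1) {N n : ℕ} (hN : 0 < N)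
    (hNδ : 2 / (N : ℝ) ≤ δ / 4) (hn : 0 < n) {V : (Fin n → Bool) → Fin n → ℝ}
    (hV : ∀ s i, |V s i| ≤ 1) (hcor : ∀ s, δ * n ≤ ∑ i, boolSign (s i) * V s i)
    {S : Finset (Fin n → Bool)} (hS : 2 ^ n * Real.exp (-(δ ^ 2 / 32 * n)) ≤ S.card) :
    ∃ (i : Fin n) (j : Fin N), ∃ S₁ ⊆ S, ∃ S₂ ⊆ S,
      (∀ s ∈ S₁, grid N (j + 1) ≤ V s i) ∧ (∀ s ∈ S₂, V s i ≤ grid N j) ∧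
      δ / 16 * S.card ≤ S₁.card ∧ δ / 16 * S.card ≤ S₂.card := by
  have hn0' : (0 : ℝ) < n := by exact_mod_cast hn
  have hα1 : δ / 16 ≤ 1 := by linarith
  have hS0 : (0 : ℝ) < S.card := lt_of_lt_of_le (by positivity) hS
  by_contra! hcon
  have hconc : ∀ i, ∃ a, |a| ≤ 1 ∧
      ((S.filter fun s => 2 / (N : ℝ) < |V s i - a|).card : ℝ) ≤ 2 * (δ / 16) * S.card := fun i =>
    exists_concentration hN (fun s => hV s i) (by positivity) hα1 S fun j hj hle => by
      by_contra! hgt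
      exact absurd (hcon i ⟨j, hj⟩ (S.filter fun s => grid N (j + 1) ≤ V s i)
        (Finset.filter_subset _ _) (S.filter fun s => V s i ≤ grid N j) (Finset.filter_subset _ _)
        (fun s hs => (Finset.mem_filter.1 hs).2) (fun s hs => (Finset.mem_filter.1 hs).2) hgt.le)
        (not_lt.2 hle)
  choose a ha1 ha using hconc
  have hup : ∑ s ∈ S, ∑ i, boolSign (s i) * V s i ≤
      δ / 4 * n * S.card + n * ((2 / N + 2 * (2 * (δ / 16))) * S.card) := by
    calc ∑ s ∈ S, ∑ i, boolSign (s i) * V s i = ∑ i, ∑ s ∈ S, boolSign (s i) * V s i :=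
          Finset.sum_comm
      _ ≤ ∑ i, (∑ s ∈ S, a i * boolSign (s i) + (2 / N + 2 * (2 * (δ / 16))) * S.card) :=
          Finset.sum_le_sum fun i _ =>
            sum_boolSign_mul_le (fun s => hV s i) (ha1 i) (by positivity) (ha i)
      _ = ∑ s ∈ S, ∑ i, a i * boolSign (s i) + n * ((2 / N + 2 * (2 * (δ / 16))) * S.card) := by
          rw [Finset.sum_add_distrib, Finset.sum_comm]; simp
      _ ≤ _ := by gcongr; exact sum_boolSign_le ha1 hδ hS
  have hlow : δ * n * S.card ≤ ∑ s ∈ S, ∑ i, boolSign (s i) * V s i := by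
    rw [mul_comm, ← nsmul_eq_mul]
    exact Finset.card_nsmul_le_sum _ _ _ fun s _ => hcor s
  have h5 : (2 / N + 2 * (2 * (δ / 16))) * S.card ≤ δ / 2 * S.card := by
    gcongr; linarith
  have h6 : 0 < δ * n * S.card := by positivity
  nlinarith [mul_le_mul_of_nonneg_left h5 hn0'.le]

/-- If every sign vector of length `p * d` correlates with some `V s`, then the `V s` shatter
at least `2 ^ d` gap assignments. -/
theorem exists_two_pow_le_card_shattered {δ : ℝ} (hδ : 0 < δ) (hδ1 : δ ≤ 1) :
    ∃ N p : ℕ, 0 < N ∧ 0 < p ∧ ∀ d : ℕ, 0 < d → ∀ V : (Fin (p * d) → Bool) → Fin (p * d) → ℝ,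
      (∀ s i, |V s i| ≤ 1) → (∀ s, δ * (p * d : ℕ) ≤ ∑ i, boolSign (s i) * V s i) →
      2 ^ d ≤ (shattered (fun j : Fin N => grid N j) (fun j : Fin N => grid N (j + 1)) V
        Set.univ).card := by
  obtain ⟨N, hN⟩ := exists_nat_gt (8 / δ)
  have hN0 : (0 : ℝ) < N := lt_trans (by positivity) hN
  have hNpos : 0 < N := by exact_mod_cast hN0
  have hNδ : 2 / (N : ℝ) ≤ δ / 4 := by
    rw [div_lt_iff₀ hδ] at hN
    rw [div_le_iff₀ hN0]; linarith
  set κ := δ ^ 2 / 32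
  have hκ : 0 < κ := by positivity
  set α := δ / 16
  have hα : 0 < α := by positivity
  have hα1 : α ≤ 1 := by simp only [α]; linarith
  obtain ⟨p, hp⟩ := exists_nat_gt (-Real.log α / κ)
  have hp' : Real.exp (-(κ * (p + 1 : ℕ))) ≤ α := by
    rw [← Real.le_log_iff_exp_le hα]
    rw [div_lt_iff₀ hκ] at hp
    push_cast
    nlinarith
  refine ⟨N, p + 1, hNpos, p.succ_pos, fun d hd => ?_⟩
  have hn0 : 0 < (p + 1) * d := Nat.mul_pos p.succ_pos hd
  have hexp : Real.exp (-(κ * ((p + 1) * d : ℕ))) ≤ α ^ d := by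
    calc Real.exp (-(κ * ((p + 1) * d : ℕ))) = Real.exp (-(κ * (p + 1 : ℕ))) ^ d := by
          rw [← Real.exp_nat_mul]; congr 1; push_cast; ring
      _ ≤ α ^ d := by gcongr
  generalize (p + 1) * d = n at hn0 hexp
  intro V hV hcor
  have hlt : ∀ j : Fin N, grid N j < grid N (j + 1) := fun j => by
    simp only [grid]; push_cast; gcongr; linarith
  rw [← Finset.coe_univ]
  refine two_pow_le_card_shattered (T := 2 ^ n * Real.exp (-(κ * n))) hlt (by positivity)
    hα.le hα1 (fun S hS => exists_split_of_correlated hδ hδ1 hNpos hNδ hn0 hV hcor hS) d _ ?_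
  rw [Finset.card_univ, Fintype.card_fun, Fintype.card_bool, Fintype.card_fin]
  push_cast
  gcongr

end Shattering

section Product

variable {X : Type*} [MeasurableSpace X]

theorem measurePreserving_finCons (ν : Measure X) [SigmaFinite ν] (n : ℕ) :
    MeasurePreserving (fun p : X × (Fin n → X) => (Fin.cons p.1 p.2 : Fin (n + 1) → X))
      (ν.prod (Measure.pi fun _ => ν)) (Measure.pi fun _ => ν) := by
  have h := (measurePreserving_piFinSuccAbove (fun _ : Fin (n + 1) => ν) 0).symm
  convert h using 2 with p
  exact (Fin.insertNth_zero' p.1 p.2).symm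

theorem lintegral_finCons (ν : Measure X) [SigmaFinite ν] {n : ℕ} {F : (Fin (n + 1) → X) → ℝ≥0∞}
    (hF : Measurable F) : ∫⁻ w, F w ∂(Measure.pi fun _ => ν) =
      ∫⁻ x, ∫⁻ w, F (Fin.cons x w) ∂(Measure.pi fun _ => ν) ∂ν := by
  have h := measurePreserving_finCons ν n
  rw [← h.lintegral_comp hF]
  exact lintegral_prod _ (hF.comp h.measurable).aemeasurable

theorem integral_finCons (ν : Measure X) [SigmaFinite ν] {n : ℕ} {F : (Fin (n + 1) → X) → ℝ}
    (hF : Measurable F) (hi : Integrable F (Measure.pi fun _ => ν)) :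
    ∫ w, F w ∂(Measure.pi fun _ => ν) =
      ∫ x, ∫ w, F (Fin.cons x w) ∂(Measure.pi fun _ => ν) ∂ν := by
  have h := measurePreserving_finCons ν n
  have hi' : Integrable (fun p : X × (Fin n → X) => F (Fin.cons p.1 p.2))
      (ν.prod (Measure.pi fun _ => ν)) :=
    h.integrable_comp_of_integrable hi
  rw [← integral_prod _ hi', ← h.map_eq,
    integral_map h.measurable.aemeasurable hF.aestronglyMeasurable]

variable [TopologicalSpace X] [CompactSpace X] [T2Space X] [BorelSpace X]

theorem exists_lt_integral_of_directed (ν : Measure X) [IsProbabilityMeasure ν] [ν.Regular]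
    {n : ℕ} {R : Fin n → Set X} (hR : ∀ i O, IsOpen O → R i ⊆ O → ν O = 1) {ι : Type*} [Nonempty ι]
    {φ : ι → (Fin n → X) → ℝ} (hc : ∀ i, Continuous (φ i)) (hm : ∀ i, Measurable (φ i))
    (h0 : ∀ i w, 0 ≤ φ i w) (h1 : ∀ i w, φ i w ≤ 1) (hd : Directed (· ≤ ·) φ)
    (hcov : ∀ w, (∀ i, w i ∈ R i) → ∀ ε > 0, ∃ i, 1 - ε < φ i w) {ε : ℝ} (hε : 0 < ε) :
    ∃ i, 1 - ε < ∫ w, φ i w ∂(Measure.pi fun _ => ν) := by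
  induction n generalizing ε with
  | zero =>
    obtain ⟨i, hi⟩ := hcov Fin.elim0 (fun i => i.elim0) ε hε
    refine ⟨i, ?_⟩
    rw [Measure.pi_of_empty, integral_dirac]
    convert hi
  | succ n ih =>
    wlog hε1 : ε ≤ 1 generalizing ε
    · obtain ⟨i, hi⟩ := this one_pos le_rfl
      exact ⟨i, by linarith [not_le.1 hε1]⟩
    have hbound : ∀ i w, ‖φ i w‖ ≤ 1 := fun i w => by
      rw [Real.norm_of_nonneg (h0 i w)]; exact h1 i w
    have hcons : ∀ x : X, Measurable fun w : Fin n → X => (Fin.cons x w : Fin (n + 1) → X) :=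
      fun x => measurable_finCons measurable_const measurable_id
    have hconsc : Continuous fun p : X × (Fin n → X) => (Fin.cons p.1 p.2 : Fin (n + 1) → X) :=
      Continuous.finCons (A := fun _ => X) continuous_fst continuous_snd
    have hint : ∀ i x, Integrable (fun w : Fin n → X => φ i (Fin.cons x w))
        (Measure.pi fun _ => ν) := fun i x =>
      Integrable.of_bound ((hm i).comp (hcons x)).aestronglyMeasurable 1
        (Eventually.of_forall fun w => hbound i _)
    have hint' : ∀ i, Integrable (φ i) (Measure.pi fun _ => ν) := fun i =>
      Integrable.of_bound (hm i).aestronglyMeasurable 1 (Eventually.of_forall fun w => hbound i _)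
    let ψ : ι → X → ℝ := fun i x => ∫ w, φ i (Fin.cons x w) ∂(Measure.pi fun _ : Fin n => ν)
    have hψ0 : ∀ i x, 0 ≤ ψ i x := fun i x => integral_nonneg fun w => h0 i _
    have hψ1 : ∀ i x, ψ i x ≤ 1 := fun i x => by
      refine (integral_mono (hint i x) (integrable_const 1) fun w => h1 i _).trans ?_
      simp
    have hψc : ∀ i, Continuous (ψ i) := fun i => by
      let G : C(X, C(Fin n → X, ℝ)) := ContinuousMap.curry ⟨_, (hc i).comp hconsc⟩
      rw [Metric.continuous_iff']
      intro x η hη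
      filter_upwards [(Metric.continuous_iff'.1 G.continuous) x (η / 2) (half_pos hη)] with y hy
      have : dist (ψ i y) (ψ i x) ≤ η / 2 := by
        rw [dist_eq_norm, ← integral_sub (hint i y) (hint i x)]
        refine (norm_integral_le_of_norm_le_const (C := η / 2)
          (Eventually.of_forall fun w => ?_)).trans ?_
        · rw [← dist_eq_norm]
          exact (ContinuousMap.dist_apply_le_dist (f := G y) (g := G x) w).trans hy.le
        · simp
      linarith
    have hopen : ∀ i, IsOpen {x | 1 - ε / 2 < ψ i x} := fun i =>
      isOpen_lt continuous_const (hψc i)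
    have hψd : Directed (· ⊆ ·) fun i => {x | 1 - ε / 2 < ψ i x} := fun i j => by
      obtain ⟨k, hik, hjk⟩ := hd i j
      exact ⟨k, fun x hx => lt_of_lt_of_le hx (integral_mono (hint i x) (hint k x) fun w => hik _),
        fun x hx => lt_of_lt_of_le hx (integral_mono (hint j x) (hint k x) fun w => hjk _)⟩
    have hU : ν (⋃ i, {x | 1 - ε / 2 < ψ i x}) = 1 := by
      refine hR 0 _ (isOpen_iUnion hopen) fun x hx => Set.mem_iUnion.2 ?_
      refine ih (R := fun i => R i.succ) (fun i => hR i.succ)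
        (φ := fun i w => φ i (Fin.cons x w))
        (fun i => (hc i).comp (hconsc.comp (Continuous.prodMk_right x)))
        (fun i => (hm i).comp (hcons x)) (fun i w => h0 i _) (fun i w => h1 i _)
        (fun i j => ?_) (fun w hw => ?_) (half_pos hε)
      · obtain ⟨k, hik, hjk⟩ := hd i j
        exact ⟨k, fun w => hik _, fun w => hjk _⟩
      · exact hcov _ (Fin.cases (by simpa using hx) (by simpa using hw))
    obtain ⟨K, hKU, hK, hνK⟩ := (isOpen_iUnion hopen).exists_lt_isCompact (μ := ν)
      (r := ENNReal.ofReal (1 - ε / 2)) (by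
        rw [hU, ENNReal.ofReal_lt_one]; linarith)
    obtain ⟨i, hKi⟩ := hK.elim_directed_cover _ hopen hKU hψd
    refine ⟨i, ?_⟩
    rw [integral_finCons ν (hm i) (hint' i)]
    have hνi : 1 - ε / 2 < ν.real {x | 1 - ε / 2 < ψ i x} := by
      rw [measureReal_def, ← ENNReal.ofReal_lt_iff_lt_toReal (by linarith) (measure_ne_top _ _)]
      exact hνK.trans_le (measure_mono hKi)
    have := mul_meas_ge_le_integral_of_nonneg (μ := ν) (f := ψ i) (Eventually.of_forall (hψ0 i))
      (Integrable.of_bound (hψc i).measurable.aestronglyMeasurable 1 (.of_forall fun x => by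
        rw [Real.norm_of_nonneg (hψ0 i x)]; exact hψ1 i x)) (1 - ε / 2)
    have h2 : ν.real {x | 1 - ε / 2 < ψ i x} ≤ ν.real {x | 1 - ε / 2 ≤ ψ i x} :=
      measureReal_mono fun x hx => by
        simp only [Set.mem_ofPred_eq] at hx ⊢
        exact hx.le
    have h3 : (1 - ε / 2) * (1 - ε / 2) ≤ (1 - ε / 2) * ν.real {x | 1 - ε / 2 ≤ ψ i x} :=
      mul_le_mul_of_nonneg_left (by linarith) (by linarith)
    change 1 - ε < ∫ x, ψ i x ∂ν
    nlinarith

theorem exists_countable_ae_lt (ν : Measure X) [IsProbabilityMeasure ν] [ν.Regular]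
    {n : ℕ} {R : Fin n → Set X} (hR : ∀ i O, IsOpen O → R i ⊆ O → ν O = 1) {ι : Type*}
    {S : ι → (Fin n → X) → ℝ} (hc : ∀ i, Continuous (S i)) (hm : ∀ i, Measurable (S i))
    {a b : ℝ} (hab : a < b) (hcov : ∀ w, (∀ i, w i ∈ R i) → ∃ i, b ≤ S i w) :
    ∃ J : Set ι, J.Countable ∧ ∀ᵐ w ∂(Measure.pi fun _ => ν), ∃ i ∈ J, a < S i w := by
  classical
  let θ : ι → (Fin n → X) → NNReal := fun i w => Real.toNNReal (min 1 ((S i w - a) / (b - a)))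
  let φ : Finset ι → (Fin n → X) → NNReal := fun F w => F.sup fun i => θ i w
  have hba : 0 < b - a := sub_pos.2 hab
  have hθ1 : ∀ i w, θ i w ≤ 1 := fun i w => by
    simp [θ]
  have hφ1 : ∀ F w, φ F w ≤ 1 := fun F w => Finset.sup_le fun i _ => hθ1 i w
  have hmφ : ∀ F, Measurable (φ F) := fun F => by
    induction F using Finset.induction_on with
    | empty => simp only [φ, Finset.sup_empty]; exact measurable_const
    | insert i F _ ih =>
      simp only [φ, Finset.sup_insert]
      exact (measurable_const.min (((hm i).sub_const a).div_const _)).real_toNNReal.sup ih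
  have hcφ : ∀ F, Continuous (φ F) := fun F =>
    Continuous.finset_sup_apply fun i _ => continuous_real_toNNReal.comp
      (continuous_const.min (((hc i).sub continuous_const).div_const _))
  have key : ∀ k : ℕ, ∃ F, 1 - 1 / ((k : ℝ) + 1) <
      ∫ w, (φ F w : ℝ) ∂(Measure.pi fun _ => ν) := fun k => by
    refine exists_lt_integral_of_directed ν hR (φ := fun F w => (φ F w : ℝ))
      (fun F => NNReal.continuous_coe.comp (hcφ F)) (fun F => (hmφ F).coe_nnreal_real)
      (fun F w => NNReal.coe_nonneg _) (fun F w => by exact_mod_cast hφ1 F w)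
      (fun F F' => ⟨F ∪ F', fun w => ?_, fun w => ?_⟩) (fun w hw ε hε => ?_) (by positivity)
    · exact NNReal.coe_le_coe.2 (Finset.sup_mono Finset.subset_union_left)
    · exact NNReal.coe_le_coe.2 (Finset.sup_mono Finset.subset_union_right)
    · obtain ⟨i, hi⟩ := hcov w hw
      refine ⟨{i}, ?_⟩
      have : 1 ≤ (S i w - a) / (b - a) := (one_le_div hba).2 (by linarith)
      simp [φ, θ, min_eq_left this, hε]
  choose F hF using key
  refine ⟨⋃ k, (F k : Set ι), Set.countable_iUnion fun k => (F k).countable_toSet, ?_⟩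
  have hJ : (⋃ k, (F k : Set ι)).Countable := Set.countable_iUnion fun k => (F k).countable_toSet
  set J := ⋃ k, (F k : Set ι)
  have hB : MeasurableSet {w | ∃ i ∈ J, a < S i w} := by
    have : {w | ∃ i ∈ J, a < S i w} = ⋃ i ∈ J, {w | a < S i w} := by ext; simp
    rw [this]
    exact MeasurableSet.biUnion hJ fun i _ => measurableSet_lt measurable_const (hm i)
  have hle : ∀ k : ℕ, 1 - 1 / ((k : ℝ) + 1) ≤
      (Measure.pi fun _ : Fin n => ν).real {w | ∃ i ∈ J, a < S i w} := fun k => by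
    refine (hF k).le.trans ?_
    rw [← integral_indicator_one hB]
    refine integral_mono (Integrable.of_bound (hmφ _).coe_nnreal_real.aestronglyMeasurable 1
      (Eventually.of_forall fun w => ?_)) ((integrable_const 1).indicator hB) fun w => ?_
    · simpa using hφ1 _ w
    · by_cases hw : w ∈ {w | ∃ i ∈ J, a < S i w}
      · rw [Set.indicator_of_mem hw]
        simpa using hφ1 _ w
      · rw [Set.indicator_of_notMem hw]
        have : φ (F k) w = 0 := by
          refine nonpos_iff_eq_zero.1 (Finset.sup_le fun i hi => ?_)
          have : S i w ≤ a := not_lt.1 fun h => hw ⟨i, Set.mem_iUnion.2 ⟨k, hi⟩, h⟩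
          have : (S i w - a) / (b - a) ≤ 0 := div_nonpos_of_nonpos_of_nonneg (by linarith) hba.le
          exact (Real.toNNReal_of_nonpos ((min_le_right _ _).trans this)).le
        simp [this]
  have h1 : 1 ≤ (Measure.pi fun _ : Fin n => ν).real {w | ∃ i ∈ J, a < S i w} := by
    refine le_of_tendsto' (x := atTop) (f := fun k : ℕ => 1 - 1 / ((k : ℝ) + 1)) ?_ hle
    simpa using tendsto_const_nhds.sub (tendsto_one_div_add_atTop_nhds_zero_nat (𝕜 := ℝ))
  refine (mem_ae_iff_prob_eq_one₀ hB.nullMeasurableSet).2 ?_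
  refine le_antisymm prob_le_one ?_
  rw [← ENNReal.ofReal_one]
  exact ENNReal.ofReal_le_of_le_toReal h1

end Product

section Crossing

variable {X : Type u} {N : ℕ}

/-- Every above/below pattern of gap crossings along the list is realised by a function in the
family. -/
def Crosses (lo hi : Fin N → ℝ) : List (X × Fin N) → Set (X → ℝ) → Prop
  | [], B => B.Nonempty
  | z :: l, B => Crosses lo hi l {f ∈ B | f z.1 ≤ lo z.2} ∧ Crosses lo hi l {f ∈ B | hi z.2 ≤ f z.1}

variable {lo hi : Fin N → ℝ}

theorem Crosses.mono {l : List (X × Fin N)} {B B' : Set (X → ℝ)} (h : B ⊆ B')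
    (hB : Crosses lo hi l B) : Crosses lo hi l B' := by
  induction l generalizing B B' with
  | nil => exact Set.Nonempty.mono h hB
  | cons z l ih =>
    exact ⟨ih (fun f hf => ⟨h hf.1, hf.2⟩) hB.1, ih (fun f hf => ⟨h hf.1, hf.2⟩) hB.2⟩

theorem hereditary_crosses (B : Set (X → ℝ)) : Hereditary {l | Crosses lo hi l B} := by
  intro l l' h
  induction h generalizing B with
  | slnil => exact id
  | cons z _ ih => exact fun hl => ih B (hl.1.mono fun f hf => hf.1)
  | cons_cons z _ ih => exact fun hl => ⟨ih _ hl.1, ih _ hl.2⟩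

theorem crosses_ofFn_iff {k : ℕ} {w : Fin k → X × Fin N} {B : Set (X → ℝ)} :
    Crosses lo hi (List.ofFn w) B ↔ ∀ b : Fin k → Bool, ∃ f ∈ B, ∀ i,
      if b i then hi (w i).2 ≤ f (w i).1 else f (w i).1 ≤ lo (w i).2 := by
  induction k generalizing B with
  | zero => simp [Crosses, Set.Nonempty]
  | succ k ih =>
    rw [List.ofFn_succ]
    simp only [Crosses, ih]
    constructor
    · rintro ⟨h₁, h₂⟩ b
      cases hb : b 0 with
      | false =>
        obtain ⟨f, hf, H⟩ := h₁ fun i => b i.succ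
        exact ⟨f, hf.1, Fin.cases (by simpa [hb] using hf.2) H⟩
      | true =>
        obtain ⟨f, hf, H⟩ := h₂ fun i => b i.succ
        exact ⟨f, hf.1, Fin.cases (by simpa [hb] using hf.2) H⟩
    · refine fun h => ⟨fun b => ?_, fun b => ?_⟩
      · obtain ⟨f, hf, H⟩ := h (Fin.cons false b)
        exact ⟨f, ⟨hf, by simpa using H 0⟩, fun i => by simpa using H i.succ⟩
      · obtain ⟨f, hf, H⟩ := h (Fin.cons true b)
        exact ⟨f, ⟨hf, by simpa using H 0⟩, fun i => by simpa using H i.succ⟩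

theorem measurableLists_crosses [MeasurableSpace X] {B : Set (X → ℝ)} (hB : B.Countable)
    (hm : ∀ f ∈ B, Measurable f) : MeasurableLists {l | Crosses lo hi l B} := fun k => by
  have e : {w : Fin k → X × Fin N | List.ofFn w ∈ {l | Crosses lo hi l B}} =
      ⋂ b : Fin k → Bool, ⋃ f ∈ B, ⋂ i, {w : Fin k → X × Fin N |
        if b i then hi (w i).2 ≤ f (w i).1 else f (w i).1 ≤ lo (w i).2} := by
    ext w
    simp [crosses_ofFn_iff]
  rw [e]
  refine MeasurableSet.iInter fun b => MeasurableSet.biUnion hB fun f hf =>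
    MeasurableSet.iInter fun i => ?_
  have h1 : Measurable fun w : Fin k → X × Fin N => f (w i).1 :=
    (hm f hf).comp (measurable_fst.comp (measurable_pi_apply i))
  have h2 : ∀ u : Fin N → ℝ, Measurable fun w : Fin k → X × Fin N => u (w i).2 := fun u =>
    (measurable_of_finite u).comp (measurable_snd.comp (measurable_pi_apply i))
  cases b i
  · simpa using measurableSet_le h1 (h2 lo)
  · simpa using measurableSet_le (h2 hi) h1

/-- The list of points paired with their assigned gaps. -/
def select {n : ℕ} (τ : Fin n → Option (Fin N)) (w : Fin n → X) : List (X × Fin N) :=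
  (List.ofFn fun i => (τ i).map fun j => (w i, j)).reduceOption

theorem select_cons_none {n : ℕ} (τ : Fin n → Option (Fin N)) (w : Fin (n + 1) → X) :
    select (Fin.cons none τ) w = select τ fun i => w i.succ := by
  simp [select, List.ofFn_succ, List.reduceOption_cons_of_none]

theorem select_cons_some {n : ℕ} (j : Fin N) (τ : Fin n → Option (Fin N)) (w : Fin (n + 1) → X) :
    select (Fin.cons (some j) τ) w = (w 0, j) :: select τ fun i => w i.succ := by
  simp [select, List.ofFn_succ, List.reduceOption_cons_of_some]

theorem crosses_select {n : ℕ} {τ : Fin n → Option (Fin N)} {w : Fin n → X} {B : Set (X → ℝ)}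
    (h : ∀ b : Fin n → Bool, ∃ f ∈ B, ∀ i j, τ i = some j →
      if b i then hi j ≤ f (w i) else f (w i) ≤ lo j) : Crosses lo hi (select τ w) B := by
  induction n generalizing B with
  | zero =>
    obtain ⟨f, hf, -⟩ := h Fin.elim0
    exact ⟨f, hf⟩
  | succ n ih =>
    induction τ using Fin.consCases with
    | _ o τ =>
    cases o with
    | none =>
      rw [select_cons_none]
      refine ih fun b => ?_
      obtain ⟨f, hf, H⟩ := h (Fin.cons false b)
      exact ⟨f, hf, fun i j hj => by simpa using H i.succ j (by simpa using hj)⟩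
    | some j₀ =>
      rw [select_cons_some]
      refine ⟨ih fun b => ?_, ih fun b => ?_⟩
      · obtain ⟨f, hf, H⟩ := h (Fin.cons false b)
        exact ⟨f, ⟨hf, by simpa using H 0 j₀⟩,
          fun i j hj => by simpa using H i.succ j (by simpa using hj)⟩
      · obtain ⟨f, hf, H⟩ := h (Fin.cons true b)
        exact ⟨f, ⟨hf, by simpa using H 0 j₀⟩,
          fun i j hj => by simpa using H i.succ j (by simpa using hj)⟩

open Classical in
/-- The number of gap assignments whose selection belongs to the family. -/
noncomputable def selectCount (D : Set (List (X × Fin N))) {n : ℕ} (w : Fin n → X) : ℝ≥0∞ :=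
  ∑ τ : Fin n → Option (Fin N), if select τ w ∈ D then 1 else 0

theorem selectCount_cons (D : Set (List (X × Fin N))) {n : ℕ} (x : X) (w : Fin n → X) :
    selectCount D (Fin.cons x w : Fin (n + 1) → X) =
      selectCount D w + ∑ j, selectCount (link D (x, j)) w := by
  classical
  unfold selectCount
  rw [← (Fin.consEquiv fun _ => Option (Fin N)).sum_comp, Fintype.sum_prod_type,
    Fintype.sum_option]
  simp [Fin.consEquiv, select_cons_none, select_cons_some, link, -Finset.sum_boole]
  rfl

variable [MeasurableSpace X]

theorem measurableSet_select {T : Type u} [MeasurableSpace T] {D : T → Set (List (X × Fin N))}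
    (hD : MeasurableFamily D) {n : ℕ} (τ : Fin n → Option (Fin N)) :
    MeasurableSet {p : T × (Fin n → X) | select τ p.2 ∈ D p.1} := by
  induction n generalizing T with
  | zero =>
    have : Measurable fun p : T × (Fin 0 → X) => (p.1, (Fin.elim0 : Fin 0 → X × Fin N)) :=
      measurable_fst.prodMk measurable_const
    simpa [Set.preimage, select] using this (hD 0)
  | succ n ih =>
    have ht : Measurable fun p : T × (Fin (n + 1) → X) => fun i : Fin n => p.2 i.succ :=
      measurable_pi_lambda _ fun i => (measurable_pi_apply _).comp measurable_snd
    induction τ using Fin.consCases with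
    | _ o τ =>
    cases o with
    | none =>
      simp only [select_cons_none]
      exact (measurable_fst.prodMk ht) (ih hD τ)
    | some j =>
      simp only [select_cons_some]
      have : Measurable fun p : T × (Fin (n + 1) → X) => (p.1, (p.2 0, j)) :=
        measurable_fst.prodMk
          (((measurable_pi_apply _).comp measurable_snd).prodMk measurable_const)
      exact (this.prodMk ht) (ih hD.link τ)

theorem measurable_selectCount {T : Type u} [MeasurableSpace T] {D : T → Set (List (X × Fin N))}
    (hD : MeasurableFamily D) (n : ℕ) :
    Measurable fun p : T × (Fin n → X) => selectCount (D p.1) p.2 := by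
  classical
  exact Finset.measurable_sum _ fun τ _ =>
    Measurable.ite (measurableSet_select hD τ) measurable_const measurable_const

/-- The uniform probability measure on `Fin N`. -/
noncomputable def uniform (N : ℕ) : Measure (Fin N) := (N : ℝ≥0∞)⁻¹ • Measure.count

instance isProbabilityMeasure_uniform [NeZero N] : IsProbabilityMeasure (uniform N) := ⟨by
  simp [uniform, Measure.count_apply_finite, ENNReal.inv_mul_cancel, NeZero.ne]⟩

theorem lintegral_uniform [NeZero N] (f : Fin N → ℝ≥0∞) :
    (N : ℝ≥0∞) * ∫⁻ j, f j ∂uniform N = ∑ j, f j := by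
  rw [uniform, lintegral_smul_measure, lintegral_count, tsum_fintype, smul_eq_mul, ← mul_assoc,
    ENNReal.mul_inv_cancel (by simp [NeZero.ne]) (by simp), one_mul]

theorem ae_uniform_iff [NeZero N] {P : Fin N → Prop} : (∀ᵐ j ∂uniform N, P j) ↔ ∀ j, P j := by
  rw [uniform, Measure.ae_ennreal_smul_measure_iff (by simp), Measure.ae_count_iff]

/-- The binomial transform of the sequence of masses. -/
noncomputable def massBinom {Z : Type u} [MeasurableSpace Z] (μ : Measure Z) (N : ℕ) :
    ℕ → ℕ → Set (List Z) → ℝ≥0∞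
  | 0, k, D => mass μ k D
  | n + 1, k, D => massBinom μ N n k D + N * massBinom μ N n (k + 1) D

theorem MeasurableLists.measurable_massBinom_link {Z : Type u} [MeasurableSpace Z] {μ : Measure Z}
    [SFinite μ] {D : Set (List Z)} (hD : MeasurableLists D) (N n k : ℕ) :
    Measurable fun z => massBinom μ N n k (StableFamily.link D z) := by
  induction n generalizing k with
  | zero => exact hD.measurable_mass_link k
  | succ n ih => exact (ih k).add ((ih (k + 1)).const_mul _)

theorem MeasurableLists.lintegral_massBinom_link {Z : Type u} [MeasurableSpace Z] {μ : Measure Z}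
    [SFinite μ] {D : Set (List Z)} (hD : MeasurableLists D) (N n k : ℕ) :
    ∫⁻ z, massBinom μ N n k (StableFamily.link D z) ∂μ = massBinom μ N n (k + 1) D := by
  induction n generalizing k with
  | zero => rfl
  | succ n ih =>
    simp only [massBinom]
    rw [lintegral_add_left (hD.measurable_massBinom_link N n k),
      lintegral_const_mul _ (hD.measurable_massBinom_link N n (k + 1)), ih, ih]

theorem massBinom_le {Z : Type u} [MeasurableSpace Z] {μ : Measure Z} {N : ℕ} {K c : ℝ≥0∞}
    {D : Set (List Z)} (h : ∀ k, mass μ k D ≤ K * c ^ k) (n k : ℕ) :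
    massBinom μ N n k D ≤ K * c ^ k * (1 + N * c) ^ n := by
  induction n generalizing k with
  | zero => simpa [massBinom] using h k
  | succ n ih =>
    calc massBinom μ N (n + 1) k D ≤ K * c ^ k * (1 + N * c) ^ n +
          N * (K * c ^ (k + 1) * (1 + N * c) ^ n) := add_le_add (ih k) (by gcongr; exact ih (k + 1))
      _ = _ := by ring

theorem lintegral_selectCount [NeZero N] (ν : Measure X) [IsProbabilityMeasure ν] (n : ℕ)
    {D : Set (List (X × Fin N))} (hD : MeasurableLists D) :
    ∫⁻ w, selectCount D w ∂(Measure.pi fun _ : Fin n => ν) =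
      massBinom (ν.prod (uniform N)) N n 0 D := by
  have hmeas : ∀ {D : Set (List (X × Fin N))} (n : ℕ), MeasurableLists D →
      Measurable fun w : Fin n → X => selectCount D w := fun n hD =>
    (measurable_selectCount (hD.const (T := PUnit.{u + 1})) n).comp
      (measurable_prodMk_left (x := PUnit.unit))
  induction n generalizing D with
  | zero =>
    rw [Measure.pi_of_empty, lintegral_dirac]
    by_cases h : [] ∈ D <;> simp [selectCount, massBinom, mass, select, h]
  | succ n ih =>
    rw [lintegral_finCons ν (hmeas _ hD)]
    simp only [selectCount_cons]
    have e : ∀ x, ∫⁻ w, (selectCount D w + ∑ j, selectCount (link D (x, j)) w)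
        ∂(Measure.pi fun _ : Fin n => ν) = massBinom (ν.prod (uniform N)) N n 0 D +
          N * ∫⁻ j, massBinom (ν.prod (uniform N)) N n 0 (link D (x, j)) ∂uniform N := fun x => by
      rw [lintegral_add_left (hmeas _ hD), ih hD, lintegral_uniform,
        lintegral_finsetSum _ fun j _ => hmeas _ (hD.link _)]
      simp_rw [ih (hD.link _)]
    have hm := hD.measurable_massBinom_link (μ := ν.prod (uniform N)) N n 0
    simp_rw [e]
    rw [lintegral_add_left measurable_const, lintegral_const, measure_univ, mul_one,
      lintegral_const_mul _ hm.lintegral_prod_right', ← lintegral_prod _ hm.aemeasurable,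
      hD.lintegral_massBinom_link]
    rfl

theorem exists_isFat {Z : Type u} [MeasurableSpace Z] {μ : Measure Z}
    [IsProbabilityMeasure μ] {D : Set (List Z)} (hD : Hereditary D) (hm : MeasurableLists D)
    {p : ℕ} (h : ∀ d : ℕ, 0 < d → 2 ^ d ≤ massBinom μ N (p * d) 0 D) :
    ∃ c : ℝ≥0∞, c ≠ 0 ∧ c ≤ 1 ∧ IsFat μ c D := by
  have hcont : Continuous fun c : ℝ≥0∞ => (1 + (N : ℝ≥0∞) * c) ^ p :=
    (ENNReal.continuous_pow p).comp
      (continuous_const.add (ENNReal.continuous_const_mul (by simp)))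
  have hev : ∀ᶠ c in 𝓝 (0 : ℝ≥0∞), (1 + (N : ℝ≥0∞) * c) ^ p < 2 :=
    hcont.tendsto' 0 1 (by simp) |>.eventually_lt_const (by simp)
  have hev1 : ∀ᶠ c in 𝓝 (0 : ℝ≥0∞), c < 1 := Iio_mem_nhds one_pos
  obtain ⟨c, ⟨hc2, hc1⟩, hc0⟩ :=
    (((hev.and hev1).filter_mono nhdsWithin_le_nhds).and
      (self_mem_nhdsWithin : Set.Ioi (0 : ℝ≥0∞) ∈ 𝓝[>] 0)).exists
  have hc0' : c ≠ 0 := (Set.mem_Ioi.1 hc0).ne'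
  have hctop : c ≠ ∞ := (hc1.trans ENNReal.one_lt_top).ne
  refine ⟨c, hc0', hc1.le, hD, hm, ?_⟩
  by_contra! hcon
  obtain ⟨j, hj⟩ := hcon
  have key : ∀ i, mass μ i D ≤ (c ^ j)⁻¹ * c ^ i := fun i => by
    have := mass_mul_pow_le μ hD hc1.le hj.le (fun h0 => by
      subst h0
      by_cases h : [] ∈ D <;> simp [mass, h] at hj ⊢) i
    rw [← ENNReal.div_eq_inv_mul]
    exact (ENNReal.le_div_iff_mul_le (Or.inl (pow_ne_zero _ hc0'))
      (Or.inl (ENNReal.pow_ne_top hctop))).2 this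
  set K := (c ^ j)⁻¹
  have hK : K ≠ ∞ := ENNReal.inv_ne_top.2 (pow_ne_zero _ hc0')
  set q := (1 + (N : ℝ≥0∞) * c) ^ p
  have hlim : Tendsto (fun d : ℕ => K * (q / 2) ^ d) atTop (𝓝 0) := by
    have h2 : q / 2 < 1 := by
      rw [ENNReal.div_lt_iff (by simp) (by simp)]; simpa using hc2
    simpa using ENNReal.Tendsto.const_mul
      (ENNReal.tendsto_pow_atTop_nhds_zero_of_lt_one h2) (Or.inr hK)
  obtain ⟨d, hd1, hd⟩ := ((hlim.eventually_lt_const one_pos).and (eventually_gt_atTop 0)).exists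
  refine absurd hd1 (not_lt.2 ?_)
  have h3 : (2 : ℝ≥0∞) ^ d ≤ K * q ^ d := by
    have := (h d hd).trans (massBinom_le key (p * d) 0)
    rwa [pow_zero, mul_one, pow_mul] at this
  rw [ENNReal.div_eq_inv_mul, mul_pow, ← ENNReal.inv_pow, mul_left_comm, ← ENNReal.div_eq_inv_mul,
    ENNReal.le_div_iff_mul_le (by simp) (by simp), one_mul]
  exact h3

end Crossing

section Conclusion

theorem AEFull.of_prod_uniform {X : Type u} [MeasurableSpace X] {N : ℕ} [NeZero N] {ν : Measure X}
    [SFinite ν] {E : Set (X × Fin N)} {k : ℕ} {D : Set (List (X × Fin N))}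
    (h : AEFull (ν.prod (uniform N)) E k D) (j : Fin N) :
    AEFull ν {x | (x, j) ∈ E} k {l | l.map (fun x => (x, j)) ∈ D} := by
  induction k generalizing D with
  | zero => exact h
  | succ k ih =>
    filter_upwards [Measure.ae_ae_of_ae_prod
      (show ∀ᵐ z ∂ν.prod (uniform N), z ∈ E → AEFull _ E k (link D z) from h)] with x hx hxE
    exact ih (ae_uniform_iff.1 hx j hxE)

theorem AEFull.of_cond {X : Type u} [MeasurableSpace X] {μ : Measure X} {E F : Set X}
    (hE : MeasurableSet E)
    (hμE : μ E ≠ ∞) {k : ℕ} {D : Set (List X)} (h : AEFull (ProbabilityTheory.cond μ E) F k D) :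
    AEFull μ (F ∩ E) k D := by
  induction k generalizing D with
  | zero => exact h
  | succ k ih =>
    have h' : ∀ᵐ x ∂μ.restrict E, x ∈ F → AEFull (ProbabilityTheory.cond μ E) F k (link D x) :=
      (Measure.ae_ennreal_smul_measure_iff (ENNReal.inv_ne_zero.2 hμE)).1 h
    rw [ae_restrict_iff' hE] at h'
    filter_upwards [h'] with x hx hxE using ih (hx hxE.2 hxE.1)

theorem AEFull.pow_le_pi {X : Type u} [MeasurableSpace X] {μ : Measure X} [SigmaFinite μ]
    {E : Set X} (hE : MeasurableSet E) {k : ℕ} {D : Set (List X)} (h : AEFull μ E k D)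
    {B : Set (Fin k → X)}
    (hB : MeasurableSet B) (hsub : ∀ w, (∀ i, w i ∈ E) → List.ofFn w ∈ D → w ∈ B) :
    μ E ^ k ≤ (Measure.pi fun _ => μ) B := by
  induction k generalizing D with
  | zero =>
    rw [Measure.pi_of_empty, Measure.dirac_apply' _ hB, Set.indicator_of_mem]
    · simp
    · exact hsub _ (fun i => i.elim0) (by simpa [AEFull] using h)
  | succ k ih =>
    have hc : ∀ x : X, Measurable fun w : Fin k → X => (Fin.cons x w : Fin (k + 1) → X) := fun x =>
      measurable_finCons measurable_const measurable_id
    rw [← lintegral_indicator_one hB, lintegral_finCons μ (measurable_one.indicator hB)]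
    calc μ E ^ (k + 1) = ∫⁻ _ in E, μ E ^ k ∂μ := by rw [setLIntegral_const, pow_succ]
      _ ≤ ∫⁻ x in E, ∫⁻ w, B.indicator 1 (Fin.cons x w) ∂(Measure.pi fun _ => μ) ∂μ := by
        refine lintegral_mono_ae ((ae_restrict_iff' hE).2 ?_)
        filter_upwards [show ∀ᵐ x ∂μ, x ∈ E → AEFull μ E k (link D x) from h] with x hx hxE
        refine (ih (hx hxE) (hc x hB) fun w hw hl => ?_).trans_eq
          (lintegral_indicator_one (hc x hB)).symm
        exact hsub _ (Fin.cases (by simpa using hxE) (by simpa using hw)) (by simpa [link] using hl)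
      _ ≤ _ := setLIntegral_le_lintegral _ _

theorem not_isMuStable_of_aeFull {X : Type u} [MeasurableSpace X] {μ : Measure X}
    [IsProbabilityMeasure μ] {A B : Set (X → ℝ)} {E : Set X} (hE : MeasurableSet E) (hμE : μ E ≠ 0)
    {N : ℕ} {lo hi : Fin N → ℝ} {j : Fin N}
    (h : ∀ k, AEFull μ E k {l | Crosses lo hi (l.map fun x => (x, j)) B}) {s r : ℝ} (hsr : s < r)
    (hBA : ∀ f ∈ B, ∃ f' ∈ A, ∀ x, (f x ≤ lo j → f' x ≤ s) ∧ (hi j ≤ f x → r ≤ f' x)) :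
    ¬ IsMuStable μ A := by
  classical
  refine not_not_intro ⟨E, s, r, hE.nullMeasurableSet, pos_iff_ne_zero.2 hμE, hsr, fun k _ => ?_⟩
  refine le_antisymm ?_ ?_
  · calc _ ≤ (Measure.pi fun _ : Fin k => μ) (Set.univ.pi fun _ => E) :=
          measure_mono fun w hw i _ => hw.1 i
      _ = _ := by rw [Measure.pi_pi]; simp
  · rw [← measure_toMeasurable (stabilityWitness A E s r k)]
    refine (h k).pow_le_pi hE (measurableSet_toMeasurable _ _) fun w hw hl =>
      subset_toMeasurable _ _ ⟨hw, fun I => ?_⟩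
    have hl' : Crosses lo hi (List.ofFn fun i => (w i, j)) B := by
      simpa [List.map_ofFn, Function.comp_def] using hl
    obtain ⟨f, hf, H⟩ := crosses_ofFn_iff.1 hl' fun i => decide (i ∉ I)
    obtain ⟨f', hf', H'⟩ := hBA f hf
    refine ⟨f', hf', fun i hi => (H' _).1 ?_, fun i hi => (H' _).2 ?_⟩
    · simpa [hi] using H i
    · simpa [hi] using H i

/-- A bounded countable family that correlates with every sign vector at almost every tuple crosses
a fixed gap in all patterns along almost every tuple from a set of positive measure. -/
theorem exists_aeFull_crosses {X : Type u} [MeasurableSpace X] (ν : Measure X)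
    [IsProbabilityMeasure ν] {B : Set (X → ℝ)} (hB : B.Countable) (hm : ∀ f ∈ B, Measurable f)
    (hb : ∀ f ∈ B, ∀ x, |f x| ≤ 1) {δ : ℝ} (hδ : 0 < δ) (hδ1 : δ ≤ 1)
    (h : ∀ n : ℕ, 0 < n → ∀ σ : Fin n → Bool, ∀ᵐ w ∂(Measure.pi fun _ : Fin n => ν),
      ∃ f ∈ B, δ * n ≤ ∑ i, boolSign (σ i) * f (w i)) :
    ∃ (N : ℕ) (lo hi : Fin N → ℝ) (j : Fin N) (E : Set X), lo j < hi j ∧ MeasurableSet E ∧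
      ν E ≠ 0 ∧ ∀ k, AEFull ν E k {l | Crosses lo hi (l.map fun x => (x, j)) B} := by
  classical
  obtain ⟨N, p, hN, hp, hcard⟩ := exists_two_pow_le_card_shattered hδ hδ1
  have : NeZero N := ⟨hN.ne'⟩
  set lo : Fin N → ℝ := fun j => grid N j
  set hi : Fin N → ℝ := fun j => grid N (j + 1)
  set D : Set (List (X × Fin N)) := {l | Crosses lo hi l B}
  have hDm : MeasurableLists D := measurableLists_crosses hB hm
  obtain ⟨c, hc0, hc1, hfat⟩ := exists_isFat (μ := ν.prod (uniform N)) (N := N)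
      (hereditary_crosses B) hDm (p := p) fun d hd => by
    rw [← lintegral_selectCount ν (p * d) hDm]
    have hae : ∀ᵐ w ∂(Measure.pi fun _ : Fin (p * d) => ν), (2 : ℝ≥0∞) ^ d ≤ selectCount D w := by
      filter_upwards [eventually_all.2 fun σ => h (p * d) (Nat.mul_pos hp hd) σ] with w hw
      choose f hf hcor using hw
      have h1 := hcard d hd (fun σ i => f σ (w i)) (fun σ i => hb _ (hf σ) _) hcor
      calc (2 : ℝ≥0∞) ^ d ≤ ((shattered lo hi (fun σ i => f σ (w i)) Set.univ).card : ℝ≥0∞) := by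
            exact_mod_cast h1
        _ ≤ selectCount D w := by
            rw [selectCount, Finset.sum_boole]
            refine Nat.cast_le.2 (Finset.card_le_card fun τ hτ => ?_)
            rw [Finset.mem_filter]
            refine ⟨Finset.mem_univ _, crosses_select fun b => ?_⟩
            obtain ⟨σ, -, H⟩ := (Finset.mem_filter.1 hτ).2 b
            exact ⟨f σ, hf σ, H⟩
    calc (2 : ℝ≥0∞) ^ d = ∫⁻ _, 2 ^ d ∂(Measure.pi fun _ : Fin (p * d) => ν) := by simp
      _ ≤ _ := lintegral_mono_ae hae
  obtain ⟨E, hE, hνE, hfull⟩ := hfat.exists_aeFull hc0 hc1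
  obtain ⟨j, hj⟩ : ∃ j : Fin N, ν {x | (x, j) ∈ E} ≠ 0 := by
    by_contra! hcon
    refine hνE ((Measure.measure_prod_null hE).2 ?_)
    have : ∀ᵐ x ∂ν, ∀ j, (x, j) ∉ E :=
      eventually_all.2 fun j => measure_eq_zero_iff_ae_notMem.1 (hcon j)
    filter_upwards [this] with x hx
    rw [Set.eq_empty_of_forall_notMem (s := Prod.mk x ⁻¹' E) hx]
    simp
  refine ⟨N, lo, hi, j, {x | (x, j) ∈ E}, ?_, measurable_prodMk_right hE, hj,
    fun k => (hfull k).of_prod_uniform j⟩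
  have : (0 : ℝ) < N := by exact_mod_cast hN
  simp only [lo, hi, grid]; push_cast; gcongr; linarith

theorem exists_lt_sum_of_mem_closure_convexHull {X : Type u} {A : Set (X → ℝ)} {g : X → ℝ}
    (hg : g ∈ closure (convexHull ℝ A)) {n : ℕ} (c : Fin n → ℝ) (w : Fin n → X) {b : ℝ}
    (h : b < ∑ i, c i * g (w i)) : ∃ f ∈ A, b < ∑ i, c i * f (w i) := by
  by_contra! hcon
  have hconv : Convex ℝ {f : X → ℝ | ∑ i, c i * f (w i) ≤ b} :=
    convex_halfSpace_le ⟨fun f f' => by simp [mul_add, Finset.sum_add_distrib],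
      fun a f => by simp only [Pi.smul_apply, smul_eq_mul, Finset.mul_sum]; congr! 1; ring⟩ b
  have hclosed : IsClosed {f : X → ℝ | ∑ i, c i * f (w i) ≤ b} :=
    isClosed_le (by fun_prop) continuous_const
  exact absurd h (not_lt.2 (closure_minimal (convexHull_min hcon hconv) hclosed hg))

/-- A function that is not almost everywhere measurable has two level sets that are both thick in
a common set of positive measure. -/
theorem exists_thick_levels {X : Type u} [MeasurableSpace X] {μ : Measure X}
    [IsProbabilityMeasure μ] {g : X → ℝ} (hg : ¬ AEMeasurable g μ) :
    ∃ (p q : ℝ) (E : Set X), p < q ∧ MeasurableSet E ∧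
      μ E ≠ 0 ∧ (∀ O, MeasurableSet O → {x | g x < p} ⊆ O → ProbabilityTheory.cond μ E O = 1) ∧
      ∀ O, MeasurableSet O → {x | q < g x} ⊆ O → ProbabilityTheory.cond μ E O = 1 := by
  have hex : ∃ p q : ℝ, p < q ∧ ∀ u v, MeasurableSet u → MeasurableSet v → {x | g x < p} ⊆ u →
      {x | q < g x} ⊆ v → μ (u ∩ v) ≠ 0 := by
    by_contra! hcon
    obtain ⟨s, hsc, hsd⟩ := TopologicalSpace.exists_countable_dense EReal
    have h : AEMeasurable (fun x => (g x : EReal)) μ := by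
      refine aemeasurable_of_exist_almost_disjoint_supersets μ s hsc hsd _ fun p _ q _ hpq => ?_
      obtain ⟨p', hp, hp'⟩ := EReal.lt_iff_exists_real_btwn.1 hpq
      obtain ⟨q', hq', hq⟩ := EReal.lt_iff_exists_real_btwn.1 hp'
      obtain ⟨u, v, hu, hv, h1, h2, h3⟩ := hcon p' q' (EReal.coe_lt_coe_iff.1 hq')
      refine ⟨u, v, hu, hv, fun x (hx : (g x : EReal) < p) => h1 ?_,
        fun x (hx : q < (g x : EReal)) => h2 ?_, h3⟩
      · exact EReal.coe_lt_coe_iff.1 (hx.trans hp)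
      · exact EReal.coe_lt_coe_iff.1 (hq.trans hx)
    exact hg (by simpa using h.ereal_toReal)
  obtain ⟨p, q, hpq, H⟩ := hex
  set u := toMeasurable μ {x | g x < p}
  set v := toMeasurable μ {x | q < g x}
  have hu : MeasurableSet u := measurableSet_toMeasurable _ _
  have hv : MeasurableSet v := measurableSet_toMeasurable _ _
  have hE0 : μ (u ∩ v) ≠ 0 := H u v hu hv (subset_toMeasurable _ _) (subset_toMeasurable _ _)
  have key : ∀ (S V O : Set X), MeasurableSet V → MeasurableSet O → S ⊆ O →
      μ (toMeasurable μ S ∩ V) ≠ 0 →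
      ProbabilityTheory.cond μ (toMeasurable μ S ∩ V) O = 1 := by
    intro S V O hV hO hSO h0
    have hm : MeasurableSet (toMeasurable μ S ∩ V) := (measurableSet_toMeasurable _ _).inter hV
    have hle : μ (toMeasurable μ S ∩ V) ≤ μ (toMeasurable μ S ∩ V ∩ O) := by
      calc μ (toMeasurable μ S ∩ V) = μ (S ∩ V) :=
            Measure.measure_toMeasurable_inter hV (measure_ne_top _ _)
        _ = μ (S ∩ (V ∩ O)) := by
            rw [Set.inter_comm V, ← Set.inter_assoc, Set.inter_eq_left.2 hSO]
        _ ≤ μ (toMeasurable μ S ∩ V ∩ O) := measure_mono fun x hx =>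
            ⟨⟨subset_toMeasurable _ _ hx.1, hx.2.1⟩, hx.2.2⟩
    rw [ProbabilityTheory.cond_apply hm, (measure_mono Set.inter_subset_left).antisymm hle,
      ENNReal.inv_mul_cancel h0 (measure_ne_top _ _)]
  refine ⟨p, q, u ∩ v, hpq, hu.inter hv, hE0, fun O hO h => key _ _ _ hv hO h hE0, fun O hO h => ?_⟩
  rw [Set.inter_comm] at hE0 ⊢
  exact key _ _ _ hu hO h hE0

end Conclusion

end StableFamily

/-- For a uniformly bounded `μ`-stable family `A` of continuous functions, every function
in the pointwise closure of the convex hull of `A` is `μ`-measurable (measurable with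
respect to the complete measure `μ`, i.e. almost everywhere measurable). Here `X → ℝ`
carries the product (pointwise convergence) topology. -/
theorem aemeasurable_of_mem_closure_convexHull {X : Type*} [TopologicalSpace X]
    [CompactSpace X] [T2Space X] [MeasurableSpace X] [BorelSpace X]
    (μ : Measure X) [IsProbabilityMeasure μ] [μ.Regular] [μ.IsComplete]
    (A : Set (X → ℝ))
    (hAcont : ∀ f ∈ A, Continuous f)
    (hAbdd : ∃ C : ℝ, ∀ f ∈ A, ∀ y : X, |f y| ≤ C)
    (hA : IsMuStable μ A)
    (g : X → ℝ) (hg : g ∈ closure (convexHull ℝ A)) :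
    AEMeasurable g μ := by
  obtain ⟨C, hC⟩ := hAbdd
  by_contra hgm
  obtain ⟨p, q, E, hpq, hE, hμE, hlow, hhigh⟩ := StableFamily.exists_thick_levels hgm
  set ν := ProbabilityTheory.cond μ E with hνdef
  have : IsProbabilityMeasure ν := ProbabilityTheory.cond_isProbabilityMeasure hμE
  have : ν.Regular := by
    have := Measure.Regular.restrict_of_measure_ne_top (measure_ne_top μ E)
    exact Measure.Regular.smul (ENNReal.inv_ne_top.2 hμE)
  set m := (p + q) / 2 with hm
  set η := (q - p) / 2 with hη
  have hη0 : 0 < η := by simp only [hη]; linarith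
  set K := |C| + |m| + η
  have hK : 0 < K := by positivity
  have hKη : η ≤ K := by simp only [K]; linarith [abs_nonneg C, abs_nonneg m]
  let T : (X → ℝ) → X → ℝ := fun f x => (f x - m) / K
  have hcov : ∀ (n : ℕ) (σ : Fin n → Bool), 0 < n → ∃ J : Set A, J.Countable ∧
      ∀ᵐ w ∂(Measure.pi fun _ : Fin n => ν), ∃ f ∈ J,
        η / 4 / K * n < ∑ i, StableFamily.boolSign (σ i) * T f (w i) := by
    intro n σ hn
    have hn' : (0 : ℝ) < n := by exact_mod_cast hn
    have hfc : ∀ f : A, Continuous (T f) :=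
      fun f => ((hAcont f f.2).sub continuous_const).div_const _
    refine StableFamily.exists_countable_ae_lt ν
      (R := fun i => if σ i then {x | q < g x} else {x | g x < p}) (fun i O hO hRO => ?_)
      (S := fun (f : A) w => ∑ i, StableFamily.boolSign (σ i) * T f (w i))
      (fun f => continuous_finsetSum _ fun i _ =>
        continuous_const.mul ((hfc f).comp (continuous_apply i)))
      (fun f => Finset.measurable_sum _ fun i _ =>
        ((hfc f).measurable.comp (measurable_pi_apply i)).const_mul _)
      (b := η / 2 / K * n) (by gcongr; linarith) fun w hw => ?_
    · cases hσ : σ i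
      · exact hlow O hO.measurableSet (by simpa [hσ] using hRO)
      · exact hhigh O hO.measurableSet (by simpa [hσ] using hRO)
    · have hterm : ∀ i, η ≤ StableFamily.boolSign (σ i) * (g (w i) - m) := fun i => by
        have := hw i
        cases hσ : σ i
        · have h : g (w i) < p := by simpa [hσ] using this
          simp only [StableFamily.boolSign, hη, hm, Bool.false_eq_true, if_false]; linarith
        · have h : q < g (w i) := by simpa [hσ] using this
          simp only [StableFamily.boolSign, hη, hm, if_true]; linarith
      have hsum : η * n ≤ ∑ i, StableFamily.boolSign (σ i) * (g (w i) - m) := by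
        have := Finset.card_nsmul_le_sum Finset.univ
          (fun i => StableFamily.boolSign (σ i) * (g (w i) - m)) η fun i _ => hterm i
        simpa [mul_comm] using this
      obtain ⟨f, hf, hlt⟩ := StableFamily.exists_lt_sum_of_mem_closure_convexHull hg
        (fun i => StableFamily.boolSign (σ i)) w
        (b := η / 2 * n + ∑ i, StableFamily.boolSign (σ i) * m) (by
          simp only [mul_sub, Finset.sum_sub_distrib] at hsum
          nlinarith)
      refine ⟨⟨f, hf⟩, ?_⟩
      have e : ∑ i, StableFamily.boolSign (σ i) * T f (w i) =
          (∑ i, StableFamily.boolSign (σ i) * f (w i) -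
            ∑ i, StableFamily.boolSign (σ i) * m) / K := by
        rw [← Finset.sum_sub_distrib, Finset.sum_div]
        exact Finset.sum_congr rfl fun i _ => by simp only [T]; ring
      rw [e, div_mul_eq_mul_div]
      gcongr
      linarith
  choose J hJc hJ using hcov
  let J' : Set A := ⋃ (n : ℕ) (σ : Fin n → Bool) (hn : 0 < n), J n σ hn
  have hJ'c : J'.Countable := Set.countable_iUnion fun n => Set.countable_iUnion fun σ =>
    Set.countable_iUnion fun hn => hJc n σ hn
  obtain ⟨N, lo, hi, j, F, hlt, hF, hνF, hfull⟩ := StableFamily.exists_aeFull_crosses ν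
    (B := (fun f : A => T f) '' J') (hJ'c.image _)
    (by
      rintro _ ⟨f, -, rfl⟩
      exact ((hAcont f f.2).measurable.sub_const m).div_const _)
    (by
      rintro _ ⟨f, -, rfl⟩ x
      simp only [T]
      rw [abs_div, abs_of_pos hK, div_le_one hK]
      have h1 := hC f f.2 x
      have h2 := abs_sub (f.1 x) m
      simp only [K]
      linarith [le_abs_self C])
    (δ := η / 4 / K) (by positivity) (by rw [div_le_one hK]; linarith)
    (fun n hn σ => by
      filter_upwards [hJ n σ hn] with w ⟨f, hf, hlt⟩
      exact ⟨T f, ⟨f, Set.mem_iUnion.2 ⟨n, Set.mem_iUnion.2 ⟨σ, Set.mem_iUnion.2 ⟨hn, hf⟩⟩⟩, rfl⟩,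
        hlt.le⟩)
  refine StableFamily.not_isMuStable_of_aeFull (hF.inter hE) ?_
    (fun k => (hfull k).of_cond hE (measure_ne_top μ E))
    (s := m + K * lo j) (r := m + K * hi j) (by gcongr) ?_ hA
  · intro h0
    refine hνF ?_
    rw [hνdef, ProbabilityTheory.cond_apply hE, Set.inter_comm, h0, mul_zero]
  · rintro _ ⟨f, -, rfl⟩
    refine ⟨f, f.2, fun x => ⟨fun h => ?_, fun h => ?_⟩⟩
    · have := (div_le_iff₀ hK).1 h
      linarith
    · have := (le_div_iff₀ hK).1 h
      linarith
end

section
/- Let X be a compact Hausdorff space, μ a complete Radon probability measure on X, and A a uniformly bounded, μ-stable family of continuous real-valued functions on X. Let (f_i) be a net in A converging pointwise on X to a function f ∈ A. Then ∫ |f_i − f| dμ → 0; that is, on a μ-stable set the topology of pointwise convergence is finer than the topology of convergence in L¹(μ). -/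
open MeasureTheory Filter Topology

/-- If `T` fills a proportion at least `c` of each fibre of a finite-valued map `q`, then the power
of `T` fills a proportion at least `c ^ card β` of each set determined by the values of `q`. -/
lemma pow_mul_measure_pi_preimage_le {X β κ : Type*} [Fintype β] [MeasurableSpace X]
    [Finite κ] [MeasurableSpace κ] [MeasurableSingletonClass κ]
    (ν : Measure X) [IsFiniteMeasure ν] {q : X → κ} (hq : Measurable q)
    {T : Set X} (hT : MeasurableSet T) {c : ENNReal}
    (hc : ∀ v, c * ν (q ⁻¹' {v}) ≤ ν (q ⁻¹' {v} ∩ T)) (R : Set (β → κ)) :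
    c ^ Fintype.card β * Measure.pi (fun _ : β => ν) {w | (fun b => q (w b)) ∈ R} ≤
      Measure.pi (fun _ : β => ν) ({w | (fun b => q (w b)) ∈ R} ∩ {w | ∀ b, w b ∈ T}) := by
  classical
  have := Fintype.ofFinite κ
  have hQ : Measurable (fun (w : β → X) b => q (w b)) := by fun_prop
  have hTT : MeasurableSet {w : β → X | ∀ b, w b ∈ T} := by
    simp only [Set.ofPred_forall]
    exact MeasurableSet.iInter fun b => measurable_pi_apply b hT
  have key : ∀ m : Measure (β → X), m {w | (fun b => q (w b)) ∈ R} =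
      ∑ v ∈ Finset.univ.filter (· ∈ R), m {w | (fun b => q (w b)) = v} := by
    intro m
    have := sum_measure_preimage_singleton (μ := m) (f := fun (w : β → X) b => q (w b))
      (Finset.univ.filter (· ∈ R)) (fun v _ => hQ (measurableSet_singleton v))
    rw [show {w : β → X | (fun b => q (w b)) ∈ R} = (fun (w : β → X) b => q (w b)) ⁻¹'
      ↑(Finset.univ.filter (· ∈ R)) by ext; simp, ← this]
    rfl
  rw [← Measure.restrict_apply' hTT, key, key, Finset.mul_sum]
  refine Finset.sum_le_sum fun v _ => ?_
  rw [Measure.restrict_apply' hTT,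
    show {w : β → X | (fun b => q (w b)) = v} = Set.univ.pi fun b => q ⁻¹' {v b} by
      ext; simp [funext_iff],
    show (Set.univ.pi fun b => q ⁻¹' {v b}) ∩ {w : β → X | ∀ b, w b ∈ T} =
      Set.univ.pi fun b => q ⁻¹' {v b} ∩ T by ext; simp [forall_and],
    Measure.pi_pi, Measure.pi_pi, Fintype.card, ← Finset.prod_const, ← Finset.prod_mul_distrib]
  exact Finset.prod_le_prod' fun b _ => hc _

/-- If the open sets `U i` eventually contain each point and the sets `T i` eventually fill a
proportion at least `c` of each measurable set, then almost every pair of tuples lies in a product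
of powers of `U i` and `T i` for some `i`. -/
lemma ae_exists_mem_of_frequently_large {X ι α β : Type*} [TopologicalSpace X] [CompactSpace X]
    [MeasurableSpace X] [Fintype α] [Fintype β]
    (ν : Measure X) [IsFiniteMeasure ν] (u : Filter ι) [u.NeBot]
    {U T : ι → Set X} (hUo : ∀ i, IsOpen (U i)) (hU : ∀ i, MeasurableSet (U i))
    (hT : ∀ i, MeasurableSet (T i)) (hmem : ∀ x, ∀ᶠ i in u, x ∈ U i)
    {c : ENNReal} (hc0 : c ≠ 0)
    (hc : ∀ B, MeasurableSet B → ∀ᶠ i in u, c * ν B ≤ ν (B ∩ T i)) :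
    ∀ᵐ p ∂(Measure.pi fun _ : α => ν).prod (Measure.pi fun _ : β => ν),
      ∃ i, (∀ a, p.1 a ∈ U i) ∧ ∀ b, p.2 b ∈ T i := by
  classical
  set M := (Measure.pi fun _ : α => ν).prod (Measure.pi fun _ : β => ν)
  let V : ι → Set ((α → X) × (β → X)) := fun i => {p | (∀ a, p.1 a ∈ U i) ∧ ∀ b, p.2 b ∈ T i}
  have hV : ∀ i, MeasurableSet (V i) := fun i => by
    have h1 : ∀ a, MeasurableSet {p : (α → X) × (β → X) | p.1 a ∈ U i} := fun a =>
      (by fun_prop : Measurable fun p : (α → X) × (β → X) => p.1 a) (hU i)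
    have h2 : ∀ b, MeasurableSet {p : (α → X) × (β → X) | p.2 b ∈ T i} := fun b =>
      (by fun_prop : Measurable fun p : (α → X) × (β → X) => p.2 b) (hT i)
    simp only [V, Set.ofPred_and, Set.ofPred_forall]
    exact (MeasurableSet.iInter h1).inter (MeasurableSet.iInter h2)
  let W : Finset ι → Set ((α → X) × (β → X)) := fun S => (⋃ i ∈ S, V i)ᶜ
  have hVS : ∀ S : Finset ι, MeasurableSet (⋃ i ∈ S, V i) := fun S =>
    S.measurableSet_biUnion fun i _ => hV i
  have step : ∀ S, ∃ S', c ^ Fintype.card β * M (W S) + M (W (S ∪ S')) ≤ M (W S) := by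
    intro S
    let q : X → (S → Prop) := fun x i => x ∈ T i
    have hq : Measurable q := measurable_pi_lambda _ fun i => measurableSet_setOfPred.1 (hT i)
    have hN : ∀ᶠ i in u, ∀ v, c * ν (q ⁻¹' {v}) ≤ ν (q ⁻¹' {v} ∩ T i) :=
      eventually_all.2 fun v => hc _ (hq (measurableSet_singleton v))
    obtain ⟨S', hS'N, hS'⟩ : ∃ S' : Finset ι,
        (∀ i ∈ S', ∀ v, c * ν (q ⁻¹' {v}) ≤ ν (q ⁻¹' {v} ∩ T i)) ∧
        ∀ x : α → X, ∃ i ∈ S', ∀ a, x a ∈ U i := by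
      let O : {i // ∀ v, c * ν (q ⁻¹' {v}) ≤ ν (q ⁻¹' {v} ∩ T i)} → Set (α → X) :=
        fun i => Set.univ.pi fun _ => U i
      obtain ⟨t, ht⟩ := isCompact_univ.elim_finite_subcover O
        (fun i => isOpen_set_pi Set.finite_univ fun _ _ => hUo i) (fun x _ => by
          obtain ⟨i, hi, hi'⟩ := (hN.and (eventually_all.2 fun a => hmem (x a))).exists
          exact Set.mem_iUnion.2 ⟨⟨i, hi⟩, fun a _ => hi' a⟩)
      refine ⟨t.image Subtype.val, ?_, fun x => ?_⟩
      · simp only [Finset.mem_image]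
        rintro _ ⟨i, _, rfl⟩
        exact i.2
      · obtain ⟨i, hi, hx⟩ := Set.mem_iUnion₂.1 (ht (Set.mem_univ x))
        exact ⟨i, Finset.mem_image_of_mem _ hi, fun a => hx a trivial⟩
    refine ⟨S', ?_⟩
    have hle : c ^ Fintype.card β * M (W S) ≤ M (W S ∩ ⋃ i ∈ S', V i) := by
      rw [Measure.prod_apply (hVS S).compl, Measure.prod_apply ((hVS S).compl.inter (hVS S')),
        ← lintegral_const_mul _ (measurable_measure_prodMk_left (hVS S).compl)]
      refine lintegral_mono fun x => ?_
      obtain ⟨i, hi, hxi⟩ := hS' x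
      let R : Set (β → S → Prop) := {v | ∀ j : S, (∀ a, x a ∈ U j) → ¬ ∀ b, v b j}
      have hR : Prod.mk x ⁻¹' W S = {w | (fun b => q (w b)) ∈ R} := by
        ext w
        simp [W, V, R, q]
      dsimp only
      rw [Set.preimage_inter, hR]
      refine (pow_mul_measure_pi_preimage_le ν hq (hT i) (hS'N i hi) R).trans
        (measure_mono (Set.inter_subset_inter_right _ fun w hw => ?_))
      exact Set.mem_iUnion₂.2 ⟨i, hi, hxi, hw⟩
    have hun : W (S ∪ S') = W S \ ⋃ i ∈ S', V i := by
      simp only [W, Finset.set_biUnion_union, Set.compl_union, Set.sdiff_eq]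
    rw [hun, ← measure_inter_add_sdiff (μ := M) (W S) (hVS S')]
    gcongr
    rwa [measure_inter_add_sdiff _ (hVS S')]
  have hinf : c ^ Fintype.card β * (⨅ S, M (W S)) + (⨅ S, M (W S)) ≤ 0 + ⨅ S, M (W S) := by
    rw [zero_add]
    refine le_iInf fun S => ?_
    obtain ⟨S', h⟩ := step S
    exact le_trans (by gcongr <;> exact iInf_le _ _) h
  have hfin : (⨅ S, M (W S)) ≠ ⊤ := ne_top_of_le_ne_top (measure_ne_top M (W ∅)) (iInf_le _ _)
  have h0 := nonpos_iff_eq_zero.1 ((ENNReal.add_le_add_iff_right hfin).1 hinf)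
  have h1 : (⨅ S, M (W S)) = 0 := (mul_eq_zero.1 h0).resolve_left (pow_ne_zero _ hc0)
  refine nonpos_iff_eq_zero.1 (h1 ▸ le_iInf fun S => measure_mono fun p hp => ?_)
  simp only [W, Set.mem_compl_iff, Set.mem_iUnion₂, not_exists]
  exact fun i _ hi => hp ⟨i, hi⟩

/-- Along an ultrafilter, the restrictions of a finite measure to measurable sets `T i` converge
setwise to a measure. -/
lemma exists_measure_tendsto_inter {X ι : Type*} [MeasurableSpace X]
    (μ : Measure X) [IsFiniteMeasure μ] (u : Ultrafilter ι) {T : ι → Set X}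
    (hT : ∀ i, MeasurableSet (T i)) :
    ∃ h : Measure X, ∀ B, MeasurableSet B → Tendsto (fun i => μ (B ∩ T i)) u (𝓝 (h B)) := by
  classical
  have hex : ∀ B, ∃ L, Tendsto (fun i => μ (B ∩ T i)) u (𝓝 L) := fun B =>
    ⟨_, (u.map fun i => μ (B ∩ T i)).le_nhds_lim⟩
  choose m hm using hex
  have m_empty : m ∅ = 0 := tendsto_nhds_unique (hm ∅) (by simp)
  have m_union : ∀ A B, MeasurableSet B → Disjoint A B → m (A ∪ B) = m A + m B := by
    intro A B hB hd
    refine tendsto_nhds_unique (hm _) (((hm A).add (hm B)).congr fun i => ?_)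
    rw [Set.union_inter_distrib_right, measure_union
      (hd.mono Set.inter_subset_left Set.inter_subset_left) (hB.inter (hT i))]
  have m_mono : ∀ A B, A ⊆ B → m A ≤ m B := fun A B h =>
    le_of_tendsto_of_tendsto' (hm A) (hm B) fun i =>
      measure_mono (Set.inter_subset_inter_left _ h)
  have m_le : ∀ A, m A ≤ μ A := fun A =>
    le_of_tendsto' (hm A) fun i => measure_mono Set.inter_subset_left
  have m_fin : ∀ (B : ℕ → Set X), (∀ n, MeasurableSet (B n)) → Pairwise (Function.onFun Disjoint B) →
      ∀ s : Finset ℕ, m (⋃ n ∈ s, B n) = ∑ n ∈ s, m (B n) := by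
    intro B hB hd s
    induction s using Finset.induction_on with
    | empty => simpa using m_empty
    | insert a s ha ih =>
      rw [Finset.set_biUnion_insert, m_union _ _ (s.measurableSet_biUnion fun n _ => hB n),
        ih, Finset.sum_insert ha]
      exact Set.disjoint_iUnion₂_right.2 fun n hn => hd fun h => ha (h ▸ hn)
  refine ⟨Measure.ofMeasurable (fun B _ => m B) m_empty ?_, fun B hB => ?_⟩
  · intro B hB hd
    refine le_antisymm ?_ ?_
    · have hsum : ∑' n, μ (B n) ≠ ⊤ := by
        rw [← measure_iUnion hd hB]
        exact measure_ne_top _ _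
      have htail := ENNReal.tendsto_tsum_compl_atTop_zero hsum
      have hsm : Tendsto (fun s : Finset ℕ => ∑ n ∈ s, m (B n)) atTop (𝓝 (∑' n, m (B n))) :=
        ENNReal.summable.hasSum
      have hlim := hsm.add htail
      rw [add_zero] at hlim
      refine ge_of_tendsto' hlim fun s => ?_
      have hs : MeasurableSet (⋃ n : {n // n ∉ s}, B n) := MeasurableSet.iUnion fun n => hB n
      calc m (⋃ n, B n) ≤ m ((⋃ n ∈ s, B n) ∪ ⋃ n : {n // n ∉ s}, B n) := by
            refine m_mono _ _ (Set.iUnion_subset fun n => ?_)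
            by_cases hn : n ∈ s
            · exact (Set.subset_biUnion_of_mem (u := B) (s := {n | n ∈ s}) hn).trans
                Set.subset_union_left
            · exact (Set.subset_iUnion (fun n : {n // n ∉ s} => B n) ⟨n, hn⟩).trans
                Set.subset_union_right
        _ = m (⋃ n ∈ s, B n) + m (⋃ n : {n // n ∉ s}, B n) := by
            refine m_union _ _ hs ?_
            simp only [Set.disjoint_iUnion_left, Set.disjoint_iUnion_right]
            exact fun j n hn => hd fun h => j.2 (h ▸ hn)
        _ ≤ _ := by
            rw [m_fin B hB hd]
            gcongr
            exact (m_le _).trans (measure_iUnion_le _)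
    · rw [ENNReal.tsum_eq_iSup_sum]
      refine iSup_le fun s => ?_
      rw [← m_fin B hB hd]
      exact m_mono _ _ (Set.iUnion₂_subset fun n _ => Set.subset_iUnion B n)
  · rw [Measure.ofMeasurable_apply _ hB]
    exact hm B

/-- If the sets `T i` have measure bounded below along an ultrafilter, then on some set `E` of positive
measure they eventually fill a fixed proportion of each measurable subset of `E`. -/
lemma exists_eventually_mul_le_measure_inter {X ι : Type*} [MeasurableSpace X]
    (μ : Measure X) [IsProbabilityMeasure μ] (u : Ultrafilter ι) {T : ι → Set X}
    (hT : ∀ i, MeasurableSet (T i)) {ε : ENNReal} (hε : ε ≠ 0) (hTε : ∀ᶠ i in u, ε ≤ μ (T i)) :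
    ∃ E, MeasurableSet E ∧ μ E ≠ 0 ∧ ∃ c : ENNReal, c ≠ 0 ∧
      ∀ B ⊆ E, MeasurableSet B → ∀ᶠ i in u, c * μ B ≤ μ (B ∩ T i) := by
  obtain ⟨h, hh⟩ := exists_measure_tendsto_inter μ u hT
  have hεh : ε ≤ h Set.univ := ge_of_tendsto (hh _ .univ) (by simpa using hTε)
  have hle : ∀ B, MeasurableSet B → h B ≤ μ B := fun B hB =>
    le_of_tendsto' (hh B hB) fun i => measure_mono Set.inter_subset_left
  have : IsFiniteMeasure h := ⟨(hle _ .univ).trans_lt (measure_lt_top _ _)⟩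
  have hεt : ε ≠ ⊤ := ne_top_of_le_ne_top (measure_ne_top h _) hεh
  have hε2 : ε / 2 ≠ ⊤ := ENNReal.div_ne_top hεt (by simp)
  have hε20 : ε / 2 ≠ 0 := (ENNReal.half_pos hε).ne'
  have : IsFiniteMeasure ((ε / 2) • μ) := μ.smul_finite hε2
  obtain ⟨E, hE, hE1, hE2⟩ := hahn_decomposition h ((ε / 2) • μ)
  refine ⟨E, hE, fun h0 => ?_, ε / 2 / 2, (ENNReal.half_pos hε20).ne', fun B hBE hB => ?_⟩
  · have h1 : h E = 0 := nonpos_iff_eq_zero.1 (h0 ▸ hle E hE)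
    have h2 : h Eᶜ ≤ ε / 2 := (hE2 _ hE.compl subset_rfl).trans (by
      simpa using mul_le_of_le_one_right' (prob_le_one (μ := μ) (s := Eᶜ)))
    rw [← measure_add_measure_compl hE, h1, zero_add] at hεh
    exact absurd (hεh.trans h2) (ENNReal.half_lt_self hε hεt).not_ge
  · rcases eq_or_ne (μ B) 0 with h0 | h0
    · simp [h0]
    · have hlt : ε / 2 / 2 * μ B < h B :=
        lt_of_lt_of_le (ENNReal.mul_lt_mul_left h0 (measure_ne_top μ B)
          (ENNReal.half_lt_self hε20 hε2)) (by simpa using hE1 B hB hBE)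
      exact ((hh B hB).eventually (lt_mem_nhds hlt)).mono fun i hi => hi.le

/-- Version of `ae_exists_mem_of_frequently_large` for tuples in a set `E`, with the coordinates
split by a finset `I`. -/
lemma ae_exists_mem_of_mem_of_large_on {X ι : Type*} [TopologicalSpace X] [CompactSpace X]
    [MeasurableSpace X] {k : ℕ} (μ : Measure X) [IsFiniteMeasure μ] (u : Filter ι) [u.NeBot]
    {U T : ι → Set X} (hUo : ∀ i, IsOpen (U i)) (hU : ∀ i, MeasurableSet (U i))
    (hT : ∀ i, MeasurableSet (T i)) (hmem : ∀ x, ∀ᶠ i in u, x ∈ U i)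
    {E : Set X} (hE : MeasurableSet E) {c : ENNReal} (hc0 : c ≠ 0)
    (hc : ∀ B ⊆ E, MeasurableSet B → ∀ᶠ i in u, c * μ B ≤ μ (B ∩ T i)) (I : Finset (Fin k)) :
    ∀ᵐ w ∂Measure.pi fun _ : Fin k => μ, (∀ j, w j ∈ E) →
      ∃ i, (∀ j ∈ I, w j ∈ U i) ∧ ∀ j ∉ I, w j ∈ T i := by
  classical
  let _ : Fintype {j // j ∈ I} := Subtype.fintype _
  have h := ae_exists_mem_of_frequently_large (α := {j // j ∈ I}) (β := {j // j ∉ I})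
    (μ.restrict E) u hUo hU hT hmem hc0 (fun B hB => by
      filter_upwards [hc (B ∩ E) Set.inter_subset_right (hB.inter hE)] with i hi
      rwa [Measure.restrict_apply hB, Measure.restrict_apply (hB.inter (hT i)),
        Set.inter_right_comm])
  have h2 := (measurePreserving_piEquivPiSubtypeProd (fun _ : Fin k => μ.restrict E)
    (· ∈ I)).quasiMeasurePreserving.ae h
  rw [← Measure.restrict_pi_pi, ae_restrict_iff' (MeasurableSet.univ_pi fun _ => hE)] at h2
  filter_upwards [h2] with w hw hwE
  obtain ⟨i, hi1, hi2⟩ := hw fun j _ => hwE j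
  exact ⟨i, fun j hj => hi1 ⟨j, hj⟩, fun j hj => hi2 ⟨j, hj⟩⟩

/-- In a `μ`-stable family, functions converging pointwise along an ultrafilter cannot stay away
from their limit, on one side, on sets of measure bounded below. -/
lemma IsMuStable.false_of_large {X ι : Type*} [TopologicalSpace X] [CompactSpace X]
    [MeasurableSpace X] [BorelSpace X] {μ : Measure X} [IsProbabilityMeasure μ]
    {A : Set (X → ℝ)} (hAcont : ∀ g ∈ A, Continuous g) (hA : IsMuStable μ A)
    (u : Ultrafilter ι) {F : ι → X → ℝ} (hF : ∀ i, F i ∈ A) {f : X → ℝ} (hf : f ∈ A)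
    (hconv : ∀ x, Tendsto (fun i => F i x) u (𝓝 (f x))) {η : ℝ} (hη : 0 < η)
    {T : ι → Set X} (hT : ∀ i, MeasurableSet (T i))
    (hTF : (∀ i, ∀ x ∈ T i, f x + η ≤ F i x) ∨ ∀ i, ∀ x ∈ T i, F i x ≤ f x - η)
    {ε : ENNReal} (hε : ε ≠ 0) (hTε : ∀ᶠ i in u, ε ≤ μ (T i)) : False := by
  have hfc := hAcont f hf
  obtain ⟨E, hE, hE0, c, hc0, hc⟩ := exists_eventually_mul_le_measure_inter μ u hT hε hTε
  obtain ⟨z, hz⟩ : ∃ z : ℤ, μ (E ∩ {x | ⌊f x / (η / 4)⌋ = z}) ≠ 0 := by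
    by_contra! h
    refine hE0 (measure_mono_null (fun x hx => ?_) (measure_iUnion_null h))
    exact Set.mem_iUnion.2 ⟨⌊f x / (η / 4)⌋, hx, rfl⟩
  set E' := E ∩ {x | ⌊f x / (η / 4)⌋ = z}
  have hE'm : MeasurableSet E' := hE.inter
    ((Int.measurable_floor.comp (hfc.measurable.div_const _)) (measurableSet_singleton z))
  have hfE : ∀ x ∈ E', z * (η / 4) ≤ f x ∧ f x < (z + 1) * (η / 4) := fun x hx => by
    have := Int.floor_eq_iff.1 hx.2
    exact ⟨(le_div_iff₀ (by positivity)).1 this.1, (div_lt_iff₀ (by positivity)).1 this.2⟩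
  have hUo : ∀ i, IsOpen {x | |F i x - f x| < η / 4} := fun i =>
    isOpen_lt ((hAcont _ (hF i)).sub hfc).abs continuous_const
  have hae : ∀ (k : ℕ) (I : Finset (Fin k)), ∀ᵐ w ∂Measure.pi fun _ : Fin k => μ,
      (∀ j, w j ∈ E') → ∃ i, (∀ j ∈ I, |F i (w j) - f (w j)| < η / 4) ∧ ∀ j ∉ I, w j ∈ T i :=
    fun k I => ae_exists_mem_of_mem_of_large_on μ u hUo (fun i => (hUo i).measurableSet) hT
      (fun x => by
        simpa [Real.dist_eq] using (Metric.tendsto_nhds.1 (hconv x)) (η / 4) (by positivity))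
      hE'm hc0 (fun B hB => hc B (hB.trans Set.inter_subset_left)) I
  have full : ∀ s r : ℝ, (∀ (k : ℕ) (I : Finset (Fin k)), ∀ᵐ w ∂Measure.pi fun _ : Fin k => μ,
      (∀ j, w j ∈ E') → ∃ g ∈ A, (∀ j ∈ I, g (w j) ≤ s) ∧ ∀ j ∉ I, r ≤ g (w j)) → ¬ s < r := by
    intro s r h hsr
    refine hA ⟨E', s, r, hE'm.nullMeasurableSet, pos_iff_ne_zero.2 hz, hsr, fun k _ => ?_⟩
    have : stabilityWitness A E' s r k =ᵐ[Measure.pi fun _ : Fin k => μ]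
        Set.univ.pi fun _ => E' := by
      filter_upwards [ae_all_iff.2 (h k)] with w hw
      refine propext ⟨fun hw' j _ => hw'.1 j, fun hw' => ?_⟩
      exact ⟨fun j => hw' j trivial, fun I => hw I fun j => hw' j trivial⟩
    rw [measure_congr this, Measure.pi_pi]
    simp
  rcases hTF with hTF | hTF
  · refine full (z * (η / 4) + 2 * (η / 4)) (z * (η / 4) + 4 * (η / 4)) (fun k I => ?_)
      (by linarith)
    filter_upwards [hae k I] with w hw hwE
    obtain ⟨i, h1, h2⟩ := hw hwE
    refine ⟨F i, hF i, fun j hj => ?_, fun j hj => ?_⟩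
    · linarith [(abs_lt.1 (h1 j hj)).2, (hfE _ (hwE j)).2]
    · linarith [hTF i _ (h2 j hj), (hfE _ (hwE j)).1]
  · refine full (z * (η / 4) - 3 * (η / 4)) (z * (η / 4) - (η / 4)) (fun k I => ?_)
      (by linarith)
    filter_upwards [hae k Iᶜ] with w hw hwE
    obtain ⟨i, h1, h2⟩ := hw hwE
    refine ⟨F i, hF i, fun j hj => ?_, fun j hj => ?_⟩
    · linarith [hTF i _ (h2 j (by simpa using hj)), (hfE _ (hwE j)).2]
    · linarith [(abs_lt.1 (h1 j (by simpa using hj))).1, (hfE _ (hwE j)).1]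

/-- On a `μ`-stable uniformly bounded family, the topology of pointwise convergence is
finer than the topology of convergence in `L¹(μ)`: if a net `(f_i)` in `A` converges
pointwise to `f ∈ A`, then `∫ |f_i − f| dμ → 0`. -/
theorem tendsto_L1_of_tendsto_pointwise {X : Type*} [TopologicalSpace X] [CompactSpace X]
    [T2Space X] [MeasurableSpace X] [BorelSpace X]
    (μ : Measure X) [IsProbabilityMeasure μ] [μ.Regular] [μ.IsComplete]
    (A : Set (X → ℝ))
    (hAcont : ∀ f ∈ A, Continuous f)
    (hAbdd : ∃ C : ℝ, ∀ f ∈ A, ∀ y : X, |f y| ≤ C)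
    (hA : IsMuStable μ A)
    {ι : Type*} (l : Filter ι) [l.NeBot] (F : ι → X → ℝ)
    (hF : ∀ i, F i ∈ A) (f : X → ℝ) (hf : f ∈ A)
    (hconv : ∀ x : X, Tendsto (fun i => F i x) l (nhds (f x))) :
    Tendsto (fun i => ∫ x, |F i x - f x| ∂μ) l (nhds 0) := by
  obtain ⟨C, hC⟩ := hAbdd
  have hfc := hAcont f hf
  by_contra hnot
  obtain ⟨ε, hε, hfreq⟩ : ∃ ε > 0, ∃ᶠ i in l, ε ≤ ∫ x, |F i x - f x| ∂μ := by
    rw [Metric.tendsto_nhds] at hnot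
    push Not at hnot
    obtain ⟨ε, hε, h⟩ := hnot
    refine ⟨ε, hε, h.mono fun i hi => ?_⟩
    rwa [Real.dist_eq, sub_zero,
      abs_of_nonneg (integral_nonneg fun x => abs_nonneg _)] at hi
  have hne : (l ⊓ 𝓟 {i | ε ≤ ∫ x, |F i x - f x| ∂μ}).NeBot := frequently_mem_iff_neBot.1 hfreq
  obtain ⟨u, hle⟩ := exists_ultrafilter_iff.2 hne
  obtain ⟨hul, hle'⟩ := le_inf_iff.1 hle
  have hu : ∀ᶠ i in u, ε ≤ ∫ x, |F i x - f x| ∂μ := le_principal_iff.1 hle'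
  let P : ι → Set X := fun i => {x | f x + ε / 2 ≤ F i x}
  let N : ι → Set X := fun i => {x | F i x ≤ f x - ε / 2}
  have hP : ∀ i, MeasurableSet (P i) := fun i =>
    (isClosed_le (hfc.add continuous_const) (hAcont _ (hF i))).measurableSet
  have hN : ∀ i, MeasurableSet (N i) := fun i =>
    (isClosed_le (hAcont _ (hF i)) (hfc.sub continuous_const)).measurableSet
  set D := max C 1
  have hD0 : 0 < D := lt_max_of_lt_right one_pos
  have hbound : ∀ i, ∫ x, |F i x - f x| ∂μ ≤ ε / 2 + 2 * D * (μ.real (P i) + μ.real (N i)) := by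
    intro i
    have hiP : Integrable ((P i).indicator fun _ => 2 * D) μ :=
      (integrable_const _).indicator (hP i)
    have hiN : Integrable ((N i).indicator fun _ => 2 * D) μ :=
      (integrable_const _).indicator (hN i)
    calc ∫ x, |F i x - f x| ∂μ
        ≤ ∫ x, (ε / 2 + ((P i).indicator (fun _ => 2 * D) x +
            (N i).indicator (fun _ => 2 * D) x)) ∂μ := by
          refine integral_mono_of_nonneg (ae_of_all _ fun x => abs_nonneg _)
            ((integrable_const _).add (hiP.add hiN)) (ae_of_all _ fun x => ?_)
          have hx : |F i x - f x| ≤ 2 * D := by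
            have h1 := (hC _ (hF i) x).trans (le_max_left C 1)
            have h2 := (hC _ hf x).trans (le_max_left C 1)
            linarith [abs_sub (F i x) (f x)]
          have hp0 : 0 ≤ (P i).indicator (fun _ => 2 * D) x :=
            Set.indicator_nonneg (fun _ _ => by positivity) x
          have hn0 : 0 ≤ (N i).indicator (fun _ => 2 * D) x :=
            Set.indicator_nonneg (fun _ _ => by positivity) x
          dsimp only
          by_cases hxP : x ∈ P i
          · rw [Set.indicator_of_mem hxP]
            linarith
          · by_cases hxN : x ∈ N i
            · rw [Set.indicator_of_mem hxN]
              linarith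
            · have h1 : F i x < f x + ε / 2 := not_le.1 hxP
              have h2 : f x - ε / 2 < F i x := not_le.1 hxN
              have : |F i x - f x| ≤ ε / 2 := abs_le.2 ⟨by linarith, by linarith⟩
              linarith
      _ = _ := by
          have hiPN : Integrable (fun x => (P i).indicator (fun _ => 2 * D) x +
              (N i).indicator (fun _ => 2 * D) x) μ := hiP.add hiN
          rw [integral_add (integrable_const _) hiPN, integral_add hiP hiN,
            integral_indicator_const _ (hP i), integral_indicator_const _ (hN i)]
          simp
          ring
  have hδ : ENNReal.ofReal (ε / (8 * D)) ≠ 0 := by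
    rw [Ne, ENNReal.ofReal_eq_zero, not_le]
    positivity
  have hor : ∀ᶠ i in u, ENNReal.ofReal (ε / (8 * D)) ≤ μ (P i) ∨
      ENNReal.ofReal (ε / (8 * D)) ≤ μ (N i) := by
    filter_upwards [hu] with i hi
    by_contra! h
    have h1 : μ.real (P i) < ε / (8 * D) := ENNReal.toReal_lt_of_lt_ofReal h.1
    have h2 : μ.real (N i) < ε / (8 * D) := ENNReal.toReal_lt_of_lt_ofReal h.2
    have h3 : 2 * D * (μ.real (P i) + μ.real (N i)) < 2 * D * (ε / (8 * D) + ε / (8 * D)) := by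
      gcongr
    have h4 : 2 * D * (ε / (8 * D) + ε / (8 * D)) = ε / 2 := by
      field_simp
      norm_num
    linarith [hbound i]
  have hconv' : ∀ x, Tendsto (fun i => F i x) u (𝓝 (f x)) := fun x => (hconv x).mono_left hul
  rcases Ultrafilter.eventually_or.1 hor with h | h
  · exact hA.false_of_large hAcont u hF hf hconv' (half_pos hε) hP (.inl fun i x hx => hx) hδ h
  · exact hA.false_of_large hAcont u hF hf hconv' (half_pos hε) hN (.inr fun i x hx => hx) hδ h
end
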